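/- arXiv:2102.02653 — 2 statements merged into one kernel-verified Lean document; each statement's English description precedes it below -/
import Mathlib

section
/- Fix an integer d ≥ 3, a finite set M, an integer r ≥ 0, μ ∈ I_d(M) and β > 0. Let G_n be uniformly distributed on G_n(d) with dn even and n ≥ d−1. There exist a constant C, depending only on (d,r), and a deterministic number s_n(β), depending on (n,d,r,β), such that for every t > 0, P( |(1/n) ln Z_{G_n}(β) − s_n(β)| ≥ t ) ≤ C exp( −n t² / (Cβ)² ), where Z_G(β) = Σ_{f∈M^n} exp( −nβ d(distr_G(f)_r, μ_r) ). -/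
open MeasureTheory Filter Topology
open scoped ENNReal Classical

noncomputable section

namespace TreeEntropy

@[ext]
structure RCG (M : Type*) where
  col : List ℕ → Option M
  adj : List ℕ × List ℕ → Bool

variable {M : Type*}

def resS (r : ℕ) (g : RCG M) : RCG M where
  col l := if l.length ≤ r then g.col l else none
  adj p := if p.1.length ≤ r ∧ p.2.length ≤ r then g.adj p else false

def rcgDist (g g' : RCG M) : ℝ :=
  ∑' r : ℕ, if resS r g = resS r g' then 0 else (2:ℝ)⁻¹ ^ r

private lemma rcg_summable (a b : RCG M) : Summable
    (fun r : ℕ => if resS r a = resS r b then (0:ℝ) else (2:ℝ)⁻¹ ^ r) := by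
  refine Summable.of_nonneg_of_le (fun r => ?_) (fun r => ?_)
    (summable_geometric_of_lt_one (by norm_num) (by norm_num : (2:ℝ)⁻¹ < 1))
  · split
    · exact le_rfl
    · positivity
  · split
    · positivity
    · exact le_rfl

private lemma rcg_nonneg (a b : RCG M) (r : ℕ) :
    (0:ℝ) ≤ if resS r a = resS r b then (0:ℝ) else (2:ℝ)⁻¹ ^ r := by
  split
  · exact le_rfl
  · positivity

private lemma rcgDist_self (g : RCG M) : rcgDist g g = 0 := by simp [rcgDist]

private lemma rcgDist_comm (g g' : RCG M) : rcgDist g g' = rcgDist g' g :=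
  tsum_congr fun r => if_congr eq_comm rfl rfl

private lemma rcgDist_triangle (g₁ g₂ g₃ : RCG M) :
    rcgDist g₁ g₃ ≤ rcgDist g₁ g₂ + rcgDist g₂ g₃ := by
  unfold rcgDist
  rw [← Summable.tsum_add (rcg_summable _ _) (rcg_summable _ _)]
  refine Summable.tsum_le_tsum (fun r => ?_) (rcg_summable _ _)
    ((rcg_summable _ _).add (rcg_summable _ _))
  have hx : (0:ℝ) ≤ (2:ℝ)⁻¹ ^ r := by positivity
  by_cases h12 : resS r g₁ = resS r g₂
  · by_cases h23 : resS r g₂ = resS r g₃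
    · rw [if_pos h12, if_pos h23, if_pos (h12.trans h23)]; linarith
    · rw [if_pos h12, if_neg h23, zero_add]
      split_ifs <;> linarith
  · by_cases h23 : resS r g₂ = resS r g₃
    · rw [if_neg h12, if_pos h23, add_zero]
      split_ifs <;> linarith
    · rw [if_neg h12, if_neg h23]
      split_ifs <;> linarith

private lemma rcgDist_eq_zero (g g' : RCG M) (h : rcgDist g g' = 0) : g = g' := by
  unfold rcgDist at h
  have hr : ∀ r : ℕ, resS r g = resS r g' := by
    intro r
    by_contra hne
    have hpos : (0:ℝ) <
        ∑' r : ℕ, if resS r g = resS r g' then (0:ℝ) else (2:ℝ)⁻¹ ^ r :=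
      Summable.tsum_pos (rcg_summable g g') (rcg_nonneg g g') r
        (by rw [if_neg hne]; positivity)
    exact absurd h hpos.ne'
  have hc : g.col = g'.col := by
    funext l
    have h1 := congrFun (congrArg RCG.col (hr l.length)) l
    simpa [resS] using h1
  have ha : g.adj = g'.adj := by
    funext p
    have h1 := congrFun (congrArg RCG.adj (hr (max p.1.length p.2.length))) p
    simpa [resS, le_max_left, le_max_right] using h1
  exact RCG.ext hc ha

instance : MetricSpace (RCG M) where
  dist := rcgDist
  dist_self := rcgDist_self
  dist_comm := rcgDist_comm
  dist_triangle := rcgDist_triangle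
  eq_of_dist_eq_zero := rcgDist_eq_zero _ _

instance : MeasurableSpace (RCG M) := borel _
instance : BorelSpace (RCG M) := ⟨rfl⟩


/-! ### The `d`-regular tree `T_d` -/

/-- A list `l = [i_k, …, i_1]` (deepest step first) is the breadth-first-search label of a
vertex of the `d`-regular tree `T_d` iff its first (root-side) step lies in `{1, …, d}` and all
subsequent steps lie in `{1, …, d-1}`. -/
def ValidTd (d : ℕ) (l : List ℕ) : Prop :=
  (∀ i ∈ l.dropLast, 1 ≤ i ∧ i ≤ d - 1) ∧ (∀ i ∈ l.getLast?, 1 ≤ i ∧ i ≤ d)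

/-- The vertex set of the `d`-regular tree `T_d`. -/
def TdVertex (d : ℕ) : Type := {l : List ℕ // ValidTd d l}

/-- The root `o` of `T_d`. -/
def rootTd (d : ℕ) : TdVertex d := ⟨[], by constructor <;> simp [List.getLast?]⟩

/-- The first neighbor `1` of the root of `T_d` (defined as the root for the degenerate case
`d = 0`, which never occurs below). -/
def node1 (d : ℕ) : TdVertex d :=
  if h : 1 ≤ d then ⟨[1], by constructor <;> simp [List.getLast?, h]⟩ else rootTd d

/-- The graph structure of the `d`-regular tree: two vertices are adjacent iff one is obtained
from the other by adding one step. -/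
def TdGraph (d : ℕ) : SimpleGraph (TdVertex d) where
  Adj v w := (∃ i, w.1 = i :: v.1) ∨ (∃ i, v.1 = i :: w.1)
  symm := ⟨by intro v w h; tauto⟩
  loopless := ⟨by
    rintro v (⟨i, h⟩ | ⟨i, h⟩) <;>
      · have := congrArg List.length h
        simp at this⟩

/-- Graph distance between two vertices of a tree encoded by their BFS labels: the nearest
common ancestor corresponds to the longest common suffix. -/
def treeDist (u w : List ℕ) : ℕ :=
  ((u.reverse.zip w.reverse).takeWhile (fun p => p.1 = p.2)).length |> fun c =>
    (u.length - c) + (w.length - c)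

/-- The ball `S_r = B_r(o)` of radius `r` around the root of `T_d`. -/
def SrSet (d r : ℕ) : Set (TdVertex d) := {v | v.1.length ≤ r}

/-- The set `E_r = B_{r-1}({o,1})` of vertices at distance at most `r-1` from the edge `{o,1}`
of `T_d` (for `r ≥ 1`). -/
def ErSet (d r : ℕ) : Set (TdVertex d) :=
  {v | v.1.length + 1 ≤ r ∨ (v.1.getLast? = some 1 ∧ v.1.length ≤ r)}

lemma ErSet_subset_SrSet (d r : ℕ) : ErSet d r ⊆ SrSet d r := by
  rintro v (h | ⟨-, h⟩) <;> simp only [SrSet, Set.mem_setOf_eq] <;> omega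

/-! ### Invariant processes on `T_d` and their entropies -/

variable (d : ℕ) (M : Type*)

/-- `I_d(M)`: the set of probability measures on `M^{T_d}` invariant under all automorphisms
of the tree `T_d`. -/
def InvMeas [MeasurableSpace M] : Set (Measure (TdVertex d → M)) :=
  {μ | IsProbabilityMeasure μ ∧
    ∀ φ : TdGraph d ≃g TdGraph d, μ.map (fun x => fun v => x (φ v)) = μ}

variable {d M}

/-- The Shannon entropy of (the distribution of) a random variable with law `μ`, a measure
with countable support on a discrete space. -/
def shannon {α : Type*} [MeasurableSpace α] (μ : Measure α) : ℝ :=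
  ∑' a : α, Real.negMulLog (μ {a}).toReal

/-- The restriction `X_S` of a process `X` on `T_d` to a subset `S` of the vertices:
the pushforward of its law. -/
def restrictTo [MeasurableSpace M] (S : Set (TdVertex d))
    (μ : Measure (TdVertex d → M)) : Measure (↥S → M) :=
  μ.map (fun x => fun v => x v.1)

/-- The annealed entropy `Σ_r(μ) = H(X_{S_r}) - (d/2) H(X_{E_r})`. -/
def SigmaR [MeasurableSpace M] (d : ℕ) (r : ℕ) (μ : Measure (TdVertex d → M)) : ℝ :=
  shannon (restrictTo (SrSet d r) μ) - (d / 2 : ℝ) * shannon (restrictTo (ErSet d r) μ)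

/-- The annealed entropy `Σ(μ) = lim_r Σ_r(μ)`: the limit of the non-increasing sequence
`r ↦ Σ_r(μ)` (`r ≥ 1`), as an extended real (the limit may be `-∞`). -/
def SigmaInf [MeasurableSpace M] (d : ℕ) (μ : Measure (TdVertex d → M)) : EReal :=
  ⨅ r : ℕ, ((SigmaR d (r + 1) μ : ℝ) : EReal)

/-- `Σ_e(X) = (d/2) H(X_{E_1}) - (d-1) H(X_o)`. -/
def SigmaE [MeasurableSpace M] (d : ℕ) (μ : Measure (TdVertex d → M)) : ℝ :=
  (d / 2 : ℝ) * shannon (restrictTo (ErSet d 1) μ)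
    - ((d : ℝ) - 1) * shannon (restrictTo ({rootTd d} : Set (TdVertex d)) μ)

/-! ### Markov processes on `T_d` -/

/-- The elementary cylinder event: the coloring takes the values prescribed by `y` on `S`. -/
def cylEvent (S : Set (TdVertex d)) (y : TdVertex d → M) : Set (TdVertex d → M) :=
  {x | ∀ v ∈ S, x v = y v}

/-- The side of the edge `{u,w}` containing `u`, in the tree `T_d`. -/
def sideOf (u w : TdVertex d) : Set (TdVertex d) :=
  {v | treeDist v.1 u.1 < treeDist v.1 w.1}

/-- `B_{r-1}({u,w})`: the set of vertices at distance at most `r-1` from the edge `{u,w}`. -/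
def edgeBall (r : ℕ) (u w : TdVertex d) : Set (TdVertex d) :=
  {v | treeDist v.1 u.1 + 1 ≤ r ∨ treeDist v.1 w.1 + 1 ≤ r}

/-- A probability measure on `M^{T_d}` is `r`-Markov on a subset `A` of `T_d` if, for every
edge `{u,w}` of `A`, conditioned on the value on the `(r-1)`-neighborhood of the edge
(within `A`), the processes on the two sides of the edge (within `A`) are independent;
equivalently, the corresponding products of cylinder probabilities agree.  For `A` the whole
tree and `r = 1` this is the edge-Markov property. -/
def rMarkovOn [MeasurableSpace M] (r : ℕ) (A : Set (TdVertex d))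
    (μ : Measure (TdVertex d → M)) : Prop :=
  ∀ u w : TdVertex d, u ∈ A → w ∈ A → (TdGraph d).Adj u w →
    ∀ F₁ F₂ : Finset (TdVertex d), ↑F₁ ⊆ sideOf u w ∩ A → ↑F₂ ⊆ sideOf w u ∩ A →
      ∀ y : TdVertex d → M,
        μ (cylEvent (↑F₁ ∪ ↑F₂ ∪ (edgeBall r u w ∩ A)) y)
            * μ (cylEvent (edgeBall r u w ∩ A) y)
          = μ (cylEvent (↑F₁ ∪ (edgeBall r u w ∩ A)) y)
            * μ (cylEvent (↑F₂ ∪ (edgeBall r u w ∩ A)) y)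

/-- A probability measure on `M^{T_d}` is `r`-Markov if, conditioned on the value on the
`(r-1)`-neighborhood of any edge, the processes on the two sides of the edge are
independent. -/
def rMarkov [MeasurableSpace M] (r : ℕ) (μ : Measure (TdVertex d → M)) : Prop :=
  rMarkovOn r Set.univ μ

/-- A probability measure on `M^{T_d}` is vertex-Markov if, conditioned on the value at a
vertex, the processes on the pending subtrees of that vertex are independent. -/
def vertexMarkov [MeasurableSpace M] (μ : Measure (TdVertex d → M)) : Prop :=
  ∀ v : TdVertex d, ∀ k : ℕ, ∀ u : Fin k → TdVertex d,
    Function.Injective u → (∀ i, (TdGraph d).Adj v (u i)) →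
    ∀ F : Fin k → Finset (TdVertex d), (∀ i, ↑(F i) ⊆ sideOf (u i) v) →
      ∀ y : TdVertex d → M,
        μ (cylEvent ((⋃ i, ↑(F i)) ∪ {v}) y) * (μ (cylEvent {v} y)) ^ (k - 1)
          = ∏ i : Fin k, μ (cylEvent (↑(F i) ∪ {v}) y)

/-- `X_{S_1}` is a vertex-Markov process on `S_1`: the values at the `d` neighbors of the
root are conditionally independent given the value at the root. -/
def vertexMarkovOnS1 [MeasurableSpace M] (d : ℕ) (μ : Measure (TdVertex d → M)) : Prop :=
  ∀ y : TdVertex d → M,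
    μ (cylEvent (SrSet d 1) y) * (μ (cylEvent ({rootTd d} : Set (TdVertex d)) y)) ^ (d - 1)
      = ∏ i ∈ Finset.Icc 1 d,
          μ (cylEvent {v : TdVertex d | v = rootTd d ∨ v.1 = [i]} y)


/-! ### The randomly labeled rooted colored graph associated to a finite colored graph

Given a finite colored graph `(G,f)` and a vertex `v`, the associated randomly labeled rooted
colored graph is obtained by a breadth-first search exploration of the connected component of
`v` started at `v`, ties between vertices being broken uniformly at random.  We implement the
uniformly random tie-breaking by a uniformly random priority permutation `σ`. -/

variable {M : Type*} {n : ℕ}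

/-- The `k`-th layer of the breadth-first search of `G` started at `v`, ordered according to
the position of the parents in the previous layer, ties being broken by the priority `σ`. -/
def bfsLayer (G : SimpleGraph (Fin n)) (v : Fin n) (σ : Equiv.Perm (Fin n)) :
    ℕ → List (Fin n)
  | 0 => [v]
  | (k + 1) =>
    let prev := bfsLayer G v σ k
    let key : Fin n → ℕ := fun w =>
      (prev.idxOf (((prev.find? (fun u => decide (G.Adj u w))).getD v))) * n + (σ w : ℕ)
    ((List.finRange n).filter
        (fun w => decide (G.Reachable v w ∧ G.dist v w = k + 1))).mergeSort
      (fun a b => key a ≤ key b)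

/-- The breadth-first-search label of the vertex `w` lying in layer `k` of the exploration of
`G` started at `v` with tie-breaking priority `σ`. -/
def bfsPathAux (G : SimpleGraph (Fin n)) (v : Fin n) (σ : Equiv.Perm (Fin n)) :
    ℕ → Fin n → Option (List ℕ)
  | 0, w => if w = v then some [] else none
  | (k + 1), w =>
    match (bfsLayer G v σ k).find? (fun u => decide (G.Adj u w)) with
    | none => none
    | some p =>
      let L := bfsLayer G v σ (k + 1)
      let j := 1 + ((L.takeWhile (fun w' => w' ≠ w)).filter
        (fun w' => (bfsLayer G v σ k).find? (fun u => decide (G.Adj u w')) = some p)).length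
      (bfsPathAux G v σ k p).map (fun pl => j :: pl)

/-- The breadth-first-search label of the vertex `w` in the exploration of the connected
component of `v` in `G`, with tie-breaking priority `σ` (`none` if `w` is not in the component
of `v`). -/
def bfsPath (G : SimpleGraph (Fin n)) (v : Fin n) (σ : Equiv.Perm (Fin n)) (w : Fin n) :
    Option (List ℕ) :=
  if G.Reachable v w then bfsPathAux G v σ (G.dist v w) w else none

/-- The rooted colored graph obtained from the colored graph `(G,f)` by the breadth-first
search exploration of the connected component of `v` rooted at `v`, with tie-breaking
priority `σ`. -/
def bfsRCG (G : SimpleGraph (Fin n)) (f : Fin n → M) (v : Fin n) (σ : Equiv.Perm (Fin n)) :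
    RCG M where
  col l := if h : ∃ w, bfsPath G v σ w = some l then some (f h.choose) else none
  adj p :=
    if (∃ w₁ w₂, bfsPath G v σ w₁ = some p.1 ∧ bfsPath G v σ w₂ = some p.2 ∧ G.Adj w₁ w₂)
    then true else false

/-- `distr_{G,v}(f)`: the law of the randomly labeled rooted colored graph obtained from the
connected component of `v` in the colored graph `(G,f)`, rooted at `v`. -/
def distrAt (G : SimpleGraph (Fin n)) (f : Fin n → M) (v : Fin n) : Measure (RCG M) :=
  ((Nat.factorial n : ℝ≥0∞))⁻¹ •
    ∑ σ : Equiv.Perm (Fin n), Measure.dirac (bfsRCG G f v σ)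

/-- `distr_G(f) = (1/|V|) ∑_{v ∈ V} distr_{G,v}(f)`. -/
def distrG (G : SimpleGraph (Fin n)) (f : Fin n → M) : Measure (RCG M) :=
  ((n : ℝ≥0∞))⁻¹ • ∑ v : Fin n, distrAt G f v

/-! ### Random regular graphs -/

/-- The set `𝓖_n(d)` of simple `d`-regular graphs on the vertex set `{1, …, n}`. -/
def regularGraphs (d n : ℕ) : Set (SimpleGraph (Fin n)) :=
  {G | ∀ v, (G.neighborSet v).ncard = d}

/-- The probability that a uniformly distributed random `d`-regular graph `G_n` on `n`
vertices belongs to `A`. -/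
def PrG (d n : ℕ) (A : Set (SimpleGraph (Fin n))) : ℝ :=
  ((regularGraphs d n ∩ A).ncard : ℝ) / ((regularGraphs d n).ncard : ℝ)

/-- The expectation of `F(G_n)` for a uniformly distributed random `d`-regular graph `G_n`
on `n` vertices. -/
def ExG (d n : ℕ) (F : SimpleGraph (Fin n) → ℝ) : ℝ :=
  (∑ᶠ G ∈ regularGraphs d n, F G) / ((regularGraphs d n).ncard : ℝ)

/-- The integers `n` for which the set of simple `d`-regular graphs on `n` vertices is
non-empty: `n ≥ d + 1` and `nd` even.  Limits `n → ∞` are taken along this set. -/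
def goodN (d : ℕ) : Set ℕ := {n | d + 1 ≤ n ∧ Even (n * d)}

/-- The filter `n → ∞` along `{n : n ≥ d+1, nd even}`. -/
def goodFilter (d : ℕ) : Filter ℕ := Filter.atTop ⊓ Filter.principal (goodN d)

/-! ### The embedding of invariant processes into rooted colored graphs -/

/-- The rooted colored graph `(T_d, x, o)` associated to a coloring `x` of `T_d` (the
canonical labeling of `T_d` is a breadth-first-search labeling; for an invariant process the
resulting law is that of the randomly labeled rooted colored graph). -/
def iotaTd (d : ℕ) (x : TdVertex d → M) : RCG M where
  col l := if h : ValidTd d l then some (x ⟨l, h⟩) else none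
  adj p :=
    if (ValidTd d p.1 ∧ ValidTd d p.2 ∧ ((∃ i, p.2 = i :: p.1) ∨ (∃ i, p.1 = i :: p.2)))
    then true else false

/-- The law, as a probability measure on rooted colored graphs, of the randomly labeled rooted
colored tree `(T_d, X, o)` where `X` has law `μ`. -/
def lawTd (d : ℕ) [MeasurableSpace M] (μ : Measure (TdVertex d → M)) : Measure (RCG M) :=
  μ.map (iotaTd d)

/-! ### Micro-state (sofic) entropy -/

/-- `𝓕_G(μ,r,ε)`: the set of colorings `f` of `G` whose radius-`r` local statistics are
`ε`-close (in the Lévy-Prokhorov distance, which generates the weak topology) to the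
radius-`r` restriction of `μ`. -/
def FSet (d : ℕ) [MeasurableSpace M] (μ : Measure (TdVertex d → M)) (r : ℕ) (ε : ℝ)
    (G : SimpleGraph (Fin n)) : Set (Fin n → M) :=
  {f | levyProkhorovDist ((distrG G f).map (resS r)) ((lawTd d μ).map (resS r)) ≤ ε}

/-- `H_{G}(μ,r,ε) = (1/n) log |𝓕_G(μ,r,ε)| ∈ {-∞} ∪ [0,∞)`. -/
def HG (d : ℕ) [MeasurableSpace M] (μ : Measure (TdVertex d → M)) (r : ℕ) (ε : ℝ)
    (G : SimpleGraph (Fin n)) : EReal :=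
  if FSet d μ r ε G = ∅ then ⊥
  else ((Real.log ((FSet d μ r ε G).ncard) / n : ℝ) : EReal)

/-- `h_n(μ,r,ε,α)`: the `α`-quantile
`sup { h ∈ {-∞} ∪ [0,∞) : ℙ(H_{G_n}(μ,r,ε) ≥ h) ≥ α }`. -/
def hquant (d : ℕ) [MeasurableSpace M] (μ : Measure (TdVertex d → M)) (r : ℕ) (ε : ℝ)
    (α : ℝ) (n : ℕ) : EReal :=
  sSup {h : EReal | (h = ⊥ ∨ 0 ≤ h) ∧
    α ≤ PrG d n {G : SimpleGraph (Fin n) | h ≤ HG d μ r ε G}}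

/-- The upper entropy `h̄(μ,r,α) = lim_{ε → 0} limsup_n h_n(μ,r,ε,α)` (the limit over `ε`
of a quantity non-decreasing in `ε`, i.e. the infimum over `ε > 0`). -/
def hbarA (d : ℕ) [MeasurableSpace M] (μ : Measure (TdVertex d → M)) (r : ℕ) (α : ℝ) :
    EReal :=
  ⨅ ε : {e : ℝ // 0 < e}, (goodFilter d).limsup (fun n => hquant d μ r ε.1 α n)

/-- The lower entropy `h̲(μ,r,α) = lim_{ε → 0} liminf_n h_n(μ,r,ε,α)`. -/
def hlowA (d : ℕ) [MeasurableSpace M] (μ : Measure (TdVertex d → M)) (r : ℕ) (α : ℝ) :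
    EReal :=
  ⨅ ε : {e : ℝ // 0 < e}, (goodFilter d).liminf (fun n => hquant d μ r ε.1 α n)

/-- `h̄(μ,r)`: the common value of `h̄(μ,r,α)`, `0 < α < 1`. -/
def hbarR (d : ℕ) [MeasurableSpace M] (μ : Measure (TdVertex d → M)) (r : ℕ) : EReal :=
  hbarA d μ r (1 / 2)

/-- `h̲(μ,r)`: the common value of `h̲(μ,r,α)`, `0 < α < 1`. -/
def hlowR (d : ℕ) [MeasurableSpace M] (μ : Measure (TdVertex d → M)) (r : ℕ) : EReal :=
  hlowA d μ r (1 / 2)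

/-- The upper sofic entropy `h̄(μ) = lim_{r → ∞} h̄(μ,r)` (the limit of a non-increasing
sequence, i.e. the infimum over `r`). -/
def hbar (d : ℕ) [MeasurableSpace M] (μ : Measure (TdVertex d → M)) : EReal :=
  ⨅ r : ℕ, hbarR d μ r

/-- The lower sofic entropy `h̲(μ) = lim_{r → ∞} h̲(μ,r)`. -/
def hlow (d : ℕ) [MeasurableSpace M] (μ : Measure (TdVertex d → M)) : EReal :=
  ⨅ r : ℕ, hlowR d μ r

/-! ### Typical processes -/

/-- The probability that the random `d`-regular graph `G_n` admits a coloring whose local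
statistics are `ε`-close to `μ`. -/
def typicalPr (d : ℕ) [MeasurableSpace M] (μ : Measure (TdVertex d → M)) (ε : ℝ) (n : ℕ) :
    ℝ :=
  PrG d n {G : SimpleGraph (Fin n) |
    ∃ f : Fin n → M, levyProkhorovDist (distrG G f) (lawTd d μ) ≤ ε}

/-- `μ ∈ I_d(M)` is weakly typical if
`lim_{ε → 0} limsup_{n → ∞} ℙ(∃ f : d(distr_{G_n}(f), μ) ≤ ε) = 1`. -/
def WeaklyTypical (d : ℕ) [MeasurableSpace M] (μ : Measure (TdVertex d → M)) : Prop :=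
  Tendsto (fun ε => (goodFilter d).limsup (fun n => typicalPr d μ ε n))
    (nhdsWithin 0 (Set.Ioi 0)) (nhds 1)

/-- `μ ∈ I_d(M)` is strongly typical if
`lim_{ε → 0} lim_{n → ∞} ℙ(∃ f : d(distr_{G_n}(f), μ) ≤ ε) = 1` (in particular the inner
limits along `n → ∞` exist). -/
def StronglyTypical (d : ℕ) [MeasurableSpace M] (μ : Measure (TdVertex d → M)) : Prop :=
  ∃ L : ℝ → ℝ,
    (∀ ε : ℝ, 0 < ε → Tendsto (fun n => typicalPr d μ ε n) (goodFilter d) (nhds (L ε))) ∧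
    Tendsto L (nhdsWithin 0 (Set.Ioi 0)) (nhds 1)


/-! ### Processes on balls of `T_d` and the sets `I_{d,r}(M)`, `I_e(M)` -/

/-- The ball `S_r` of `T_d` as an induced subgraph. -/
def SrGraph (d r : ℕ) : SimpleGraph ↥(SrSet d r) := (TdGraph d).induce (SrSet d r)

/-- The set `E_r` of `T_d` as an induced subgraph. -/
def ErGraph (d r : ℕ) : SimpleGraph ↥(ErSet d r) := (TdGraph d).induce (ErSet d r)

lemma root_mem_Er (d r : ℕ) (hr : 1 ≤ r) : rootTd d ∈ ErSet d r := by
  left; simpa [rootTd] using hr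

lemma node1_mem_Er (d r : ℕ) (hr : 1 ≤ r) : node1 d ∈ ErSet d r := by
  by_cases h : 1 ≤ d
  · right
    constructor <;> simp [node1, h, List.getLast?, hr]
  · simpa [node1, h] using root_mem_Er d r hr

variable {M : Type*}

/-- The restriction to `E_r ⊆ S_r` of a probability measure on `M^{S_r}`. -/
def restrictErOfSr [MeasurableSpace M] (d r : ℕ) (p : Measure (↥(SrSet d r) → M)) :
    Measure (↥(ErSet d r) → M) :=
  p.map (fun x => fun v : ↥(ErSet d r) => x ⟨v.1, ErSet_subset_SrSet d r v.2⟩)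

/-- `I_{d,r}(M)`: the set of probability measures on `M^{S_r}` which are invariant under the
automorphisms of `S_r` and whose restriction to `E_r` is invariant under switching the two
sides of the edge `{o,1}`. -/
def IdrMeas (d r : ℕ) (M : Type*) [MeasurableSpace M] :
    Set (Measure (↥(SrSet d r) → M)) :=
  {p | IsProbabilityMeasure p ∧
    (∀ φ : SrGraph d r ≃g SrGraph d r, p.map (fun x => fun v => x (φ v)) = p) ∧
    (∀ ψ : ErGraph d r ≃g ErGraph d r,
      (∀ hv : rootTd d ∈ ErSet d r, ((ψ ⟨rootTd d, hv⟩ : ↥(ErSet d r)) : TdVertex d) = node1 d) →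
      (restrictErOfSr d r p).map (fun x => fun v => x (ψ v)) = restrictErOfSr d r p)}

/-- The annealed entropy `Σ(p) = H(X_{S_r}) - (d/2) H(X_{E_r})` of `p ∈ I_{d,r}(M)`. -/
def SigmaP [MeasurableSpace M] (d r : ℕ) (p : Measure (↥(SrSet d r) → M)) : ℝ :=
  shannon p - (d / 2 : ℝ) * shannon (restrictErOfSr d r p)

/-- The involution of `E_1 = {o, 1}` switching the two sides of the edge `{o,1}`. -/
def swapE1 (d : ℕ) : ↥(ErSet d 1) → ↥(ErSet d 1) := fun v =>
  if (v : TdVertex d) = rootTd d then ⟨node1 d, node1_mem_Er d 1 le_rfl⟩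
  else ⟨rootTd d, root_mem_Er d 1 le_rfl⟩

/-- `I_e(M)`: the set of probability measures on `M^{E_1}` invariant under switching the two
sides of the edge `{o,1}`. -/
def IeMeas (d : ℕ) (M : Type*) [MeasurableSpace M] : Set (Measure (↥(ErSet d 1) → M)) :=
  {p | IsProbabilityMeasure p ∧ p.map (fun x => fun v => x (swapE1 d v)) = p}

/-- The annealed entropy `Σ(p) = (d/2) H(X_{E_1}) - (d-1) H(X_o)` of `p ∈ I_e(M)`. -/
def SigmaPe [MeasurableSpace M] (d : ℕ) (p : Measure (↥(ErSet d 1) → M)) : ℝ :=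
  (d / 2 : ℝ) * shannon p
    - ((d : ℝ) - 1) * shannon (p.map (fun x => x ⟨rootTd d, root_mem_Er d 1 le_rfl⟩))

/-! ### Factor graphs: functions of rooted unlabeled colored graphs of radius `r` -/

/-- The vertex set of a rooted colored graph. -/
def vertsOf (g : RCG M) : Set (List ℕ) := {l | g.col l ≠ none}

/-- An isomorphism of rooted colored graphs (a color- and adjacency-preserving bijection of
the vertex sets mapping root to root). -/
def RCGRootedIso (g g' : RCG M) : Prop :=
  ∃ e : ↥(vertsOf g) ≃ ↥(vertsOf g'),
    (∀ v, g'.col ((e v) : List ℕ) = g.col (v : List ℕ)) ∧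
    (∀ v w, g'.adj (((e v) : List ℕ), ((e w) : List ℕ)) = g.adj ((v : List ℕ), (w : List ℕ))) ∧
    (∀ h : [] ∈ vertsOf g, ∀ _ : [] ∈ vertsOf g', ((e ⟨[], h⟩) : List ℕ) = [])

/-- A function on rooted unlabeled colored graphs of radius `r`: a function of rooted colored
graphs which only depends on the isomorphism class of the ball of radius `r` around the
root. -/
def IsRadiusRFn (r : ℕ) (ψ : RCG M → ℝ) : Prop :=
  ∀ g g' : RCG M, RCGRootedIso (resS r g) (resS r g') → ψ g = ψ g'

/-- The value `ψ((G,f,v)_r)` of `ψ` at the rooted unlabeled colored graph given by the ball of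
radius `r` around `v` in `(G,f)` (computed as the average over the random labelings, which is
the constant value of `ψ` on them when `ψ` is a function of the unlabeled graph). -/
def psiAt {n : ℕ} (G : SimpleGraph (Fin n)) (f : Fin n → M) (v : Fin n) (ψ : RCG M → ℝ) :
    ℝ :=
  ∫ g, ψ g ∂(distrAt G f v)

/-- The partition function `Z_G = ∑_f ∏_v exp(ψ((G,f,v)_r))` of the factor model `ψ`. -/
def ZG {n : ℕ} [Fintype M] (G : SimpleGraph (Fin n)) (ψ : RCG M → ℝ) : ℝ :=
  ∑ f : Fin n → M, Real.exp (∑ v : Fin n, psiAt G f v ψ)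

/-- The ground-state energy `L_G = max_f ∑_v ψ((G,f,v)_r)`. -/
def LG {n : ℕ} (G : SimpleGraph (Fin n)) (ψ : RCG M → ℝ) : ℝ :=
  sSup {x : ℝ | ∃ f : Fin n → M, x = ∑ v : Fin n, psiAt G f v ψ}

/-- The canonical rooted colored graph associated to a coloring of the ball `S_r` of `T_d`. -/
def iotaSr (d r : ℕ) (x : ↥(SrSet d r) → M) : RCG M where
  col l := if h : ValidTd d l ∧ l.length ≤ r then some (x ⟨⟨l, h.1⟩, h.2⟩) else none
  adj p := if (ValidTd d p.1 ∧ ValidTd d p.2 ∧ p.1.length ≤ r ∧ p.2.length ≤ r ∧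
      ((∃ i, p.2 = i :: p.1) ∨ (∃ i, p.1 = i :: p.2))) then true else false

/-- `⟨p, ψ⟩ = E[ψ(X)]` where `X` has law `p ∈ I_{d,r}(M)`. -/
def pairing [MeasurableSpace M] (d r : ℕ) (p : Measure (↥(SrSet d r) → M))
    (ψ : RCG M → ℝ) : ℝ :=
  ∫ x, ψ (iotaSr d r x) ∂p

/-! ### Annealed quantities for random regular graphs -/

/-- `log` with the convention `log 0 = -∞`, with values in the extended reals. -/
def elog (x : ℝ) : EReal := if x ≤ 0 then ⊥ else ((Real.log x : ℝ) : EReal)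

/-- The set `𝓖_n(μ,r,ε)` of pairs `(G,f)` of a `d`-regular graph together with a coloring
whose radius-`r` local statistics are `ε`-close to `μ_r`. -/
def GnPairs (d : ℕ) [MeasurableSpace M] (μ : Measure (TdVertex d → M)) (r : ℕ) (ε : ℝ)
    (n : ℕ) : Set (SimpleGraph (Fin n) × (Fin n → M)) :=
  {Gf | Gf.1 ∈ regularGraphs d n ∧ Gf.2 ∈ FSet d μ r ε Gf.1}

/-- The annealed entropy
`Σ_n(μ,r,ε) = (1/n) (log |𝓖_n(μ,r,ε)| - log |𝓖_n(d)|) = (1/n) log E |𝓕_{G_n}(μ,r,ε)|`. -/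
def SigmaN (d : ℕ) [MeasurableSpace M] (μ : Measure (TdVertex d → M)) (r : ℕ) (ε : ℝ)
    (n : ℕ) : EReal :=
  (((n : ℝ)⁻¹ : ℝ) : EReal) *
    elog (((GnPairs d μ r ε n).ncard : ℝ) / ((regularGraphs d n).ncard : ℝ))

/-- The relaxed partition function `Z_G(β) = ∑_f exp(-nβ d(distr_G(f)_r, μ_r))`. -/
def ZGbeta (d : ℕ) [MeasurableSpace M] {n : ℕ} [Fintype M] (μ : Measure (TdVertex d → M))
    (r : ℕ) (β : ℝ) (G : SimpleGraph (Fin n)) : ℝ :=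
  ∑ f : Fin n → M, Real.exp (-(n : ℝ) * β *
    levyProkhorovDist ((distrG G f).map (resS r)) ((lawTd d μ).map (resS r)))


/-! ### Processes on unimodular Galton-Watson trees

A colored rooted tree `(T, X, o)` with `T` a subtree of the label set, rooted at `[]` and
with the children of a vertex `v` labeled `1 :: v, …, N_v :: v`, is encoded as a rooted
colored graph in `RCG M`. -/

/-- `g` is a canonically labeled colored rooted tree. -/
def IsCanonTree (g : RCG M) : Prop :=
  g.col [] ≠ none ∧
  (∀ l : List ℕ, g.col l ≠ none → g.col l.tail ≠ none) ∧
  (∀ (v : List ℕ) (i : ℕ), 1 ≤ i → g.col ((i + 1) :: v) ≠ none → g.col (i :: v) ≠ none) ∧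
  (∀ v : List ℕ, g.col (0 :: v) = none) ∧
  (∀ p : List ℕ × List ℕ, g.adj p = true ↔
    (g.col p.1 ≠ none ∧ g.col p.2 ≠ none ∧
      ((∃ i, p.2 = i :: p.1) ∨ (∃ i, p.1 = i :: p.2))))

/-- A finite canonically labeled tree. -/
def IsFinTree (t : Finset (List ℕ)) : Prop :=
  [] ∈ t ∧ (∀ l ∈ t, l.tail ∈ t) ∧
  (∀ (v : List ℕ) (i : ℕ), 1 ≤ i → ((i + 1) :: v) ∈ t → (i :: v) ∈ t) ∧
  (∀ v : List ℕ, (0 :: v) ∉ t)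

/-- The number of children of the vertex `v` in the finite tree `t`. -/
def childCountF (t : Finset (List ℕ)) (v : List ℕ) : ℕ :=
  (t.filter (fun w => w ≠ [] ∧ w.tail = v)).card

/-- The size-biased version `π̂(k) = (k+1) π(k+1) / d` of the offspring distribution `π`. -/
def sizeBiased (π : ℕ → ℝ) (dd : ℝ) (k : ℕ) : ℝ := (k + 1 : ℝ) * π (k + 1) / dd

/-- The probability that the unimodular Galton-Watson tree with degree distribution `π`,
truncated at depth `k`, equals the finite tree `t`. -/
def treeWeight (π : ℕ → ℝ) (dd : ℝ) (k : ℕ) (t : Finset (List ℕ)) : ℝ :=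
  π (childCountF t []) *
    ∏ v ∈ t.filter (fun v => v ≠ [] ∧ v.length < k), sizeBiased π dd (childCountF t v)

/-- The law of the underlying tree is the unimodular Galton-Watson law `UGW(π)`:
all finite-depth truncations have the prescribed distribution. -/
def IsUGWTreeLaw (π : ℕ → ℝ) (dd : ℝ) (μ : Measure (RCG M)) : Prop :=
  ∀ (k : ℕ) (t : Finset (List ℕ)), IsFinTree t → (∀ v ∈ t, v.length ≤ k) →
    (μ {g | ∀ l : List ℕ, l.length ≤ k → (g.col l ≠ none ↔ l ∈ t)}).toReal
      = treeWeight π dd k t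

/-- `e` realizes an isomorphism (not necessarily root-preserving) of the colored graphs `g`
and `g'`. -/
def IsIsoVia (g g' : RCG M) (e : List ℕ → List ℕ) : Prop :=
  Set.BijOn e (vertsOf g) (vertsOf g') ∧
  (∀ l ∈ vertsOf g, g'.col (e l) = g.col l) ∧
  (∀ l ∈ vertsOf g, ∀ l' ∈ vertsOf g, g'.adj (e l, e l') = g.adj (l, l'))

/-- A function on doubly rooted colored graphs, invariant under isomorphisms. -/
def PairInvariant (F : RCG M → List ℕ → List ℕ → ℝ≥0∞) : Prop :=
  ∀ g g' e, IsIsoVia g g' e → ∀ u ∈ vertsOf g, ∀ v ∈ vertsOf g, F g' (e u) (e v) = F g u v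

/-- Unimodularity (the mass-transport principle):
`E ∑_v F(G,o,v) = E ∑_v F(G,v,o)` for all isomorphism-invariant `F ≥ 0`. -/
def Unimodular (μ : Measure (RCG M)) : Prop :=
  ∀ F : RCG M → List ℕ → List ℕ → ℝ≥0∞, PairInvariant F →
    ∫⁻ g, (∑' v : ↥(vertsOf g), F g [] (v : List ℕ)) ∂μ
      = ∫⁻ g, (∑' v : ↥(vertsOf g), F g (v : List ℕ) []) ∂μ

/-- `I_π(M)`: the laws of invariant (unimodular) processes `(T,X)` with colors in `M` over
the unimodular Galton-Watson tree with degree distribution `π` (of mean `dd`). -/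
def IPiMeas (π : ℕ → ℝ) (dd : ℝ) (M : Type*) [MeasurableSpace M] :
    Set (Measure (RCG M)) :=
  {μ | IsProbabilityMeasure μ ∧ μ {g | IsCanonTree g} = 1 ∧ Unimodular μ ∧
    IsUGWTreeLaw π dd μ}

/-- The root degree `deg(o)` of a canonically labeled tree (the number of children of the
root). -/
def rootDeg (g : RCG M) : ℕ := {i : ℕ | g.col [i] ≠ none}.ncard

/-- The edge-biased law `→μ(⬝) = (1/d) E[deg(o) 1{(T,X,(o,1)) ∈ ⬝}]` on colored edge-rooted
trees (the root edge being `([], [1])`). -/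
def vecLaw (dd : ℝ) [MeasurableSpace M] (μ : Measure (RCG M)) : Measure (RCG M) :=
  (ENNReal.ofReal dd)⁻¹ • μ.withDensity (fun g => (rootDeg g : ℝ≥0∞))

/-- Membership in `E_r = B_{r-1}({o,1})` for a vertex of a canonically labeled tree. -/
def inErL (r : ℕ) (l : List ℕ) : Prop :=
  l.length + 1 ≤ r ∨ (l.getLast? = some 1 ∧ l.length ≤ r)

/-- The restriction of a colored edge-rooted tree to `E_r = B_{r-1}({o,1})`. -/
def resE (r : ℕ) (g : RCG M) : RCG M where
  col l := if inErL r l then g.col l else none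
  adj p := if inErL r p.1 ∧ inErL r p.2 then g.adj p else false

/-- The Shannon entropy `H(π)` of the probability mass function `π`. -/
def Hpmf (π : ℕ → ℝ) : ℝ := ∑' k : ℕ, Real.negMulLog (π k)

/-- The annealed entropy `Σ_r(μ) = H(X_{S_r}) - (d/2) H(→X_{E_r}) - H(π)` of an invariant
process over the unimodular Galton-Watson tree. -/
def SigmaUGW (π : ℕ → ℝ) (dd : ℝ) [MeasurableSpace M] (r : ℕ) (μ : Measure (RCG M)) : ℝ :=
  shannon (μ.map (resS r)) - (dd / 2) * shannon ((vecLaw dd μ).map (resE r)) - Hpmf π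

/-- `Σ(μ) = lim_{r → ∞} Σ_r(μ)` (the limit of a non-increasing sequence). -/
def SigmaUGWInf (π : ℕ → ℝ) (dd : ℝ) [MeasurableSpace M] (μ : Measure (RCG M)) : EReal :=
  ⨅ r : ℕ, ((SigmaUGW π dd (r + 1) μ : ℝ) : EReal)

/-- `Σ_e(X) = (d/2) H(→X_{E_1}) - d H(→X_o) + H(X_o) - H(π)`. -/
def SigmaEUGW (π : ℕ → ℝ) (dd : ℝ) [MeasurableSpace M] (μ : Measure (RCG M)) : ℝ :=
  (dd / 2) * shannon ((vecLaw dd μ).map (resE 1))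
    - dd * shannon ((vecLaw dd μ).map (resS 0))
    + shannon (μ.map (resS 0)) - Hpmf π

/-! ### Markov processes on random trees -/

/-- The side of the (potential) edge `{u,w}` containing `u`, among the labels. -/
def sideL (u w : List ℕ) : Set (List ℕ) := {v | treeDist v u < treeDist v w}

/-- `B_{r-1}({u,w})` among the labels. -/
def edgeBallL (r : ℕ) (u w : List ℕ) : Set (List ℕ) :=
  {v | treeDist v u + 1 ≤ r ∨ treeDist v w + 1 ≤ r}

/-- The event that the tree structure agrees with that of `y` on `S` and that the colored
tree agrees with `y` on `B`. -/
def treeCylEvent (S B : Set (List ℕ)) (y : RCG M) : Set (RCG M) :=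
  {g | (∀ l ∈ S, (g.col l ≠ none ↔ y.col l ≠ none)) ∧ (∀ l ∈ B, g.col l = y.col l)}

/-- A random colored tree is `r`-Markov on the ambient set `A` if, conditioned on the tree
and on the value on the `(r-1)`-neighborhood of an edge, the processes on the two sides of
the edge are independent (conditioning on the tree is expressed through arbitrary finite
windows `S`). -/
def rMarkovTreeOn [MeasurableSpace M] (r : ℕ) (A : Set (List ℕ)) (μ : Measure (RCG M)) :
    Prop :=
  ∀ (u : List ℕ) (i : ℕ), 1 ≤ i → u ∈ A → (i :: u) ∈ A →
    ∀ F₁ F₂ : Finset (List ℕ), ↑F₁ ⊆ sideL u (i :: u) ∩ A → ↑F₂ ⊆ sideL (i :: u) u ∩ A →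
    ∀ S : Finset (List ℕ), ↑S ⊆ A → ∀ y : RCG M,
      μ (treeCylEvent ↑S (edgeBallL r u (i :: u) ∩ A) y ∩
          treeCylEvent ∅ ↑F₁ y ∩ treeCylEvent ∅ ↑F₂ y)
        * μ (treeCylEvent ↑S (edgeBallL r u (i :: u) ∩ A) y)
      = μ (treeCylEvent ↑S (edgeBallL r u (i :: u) ∩ A) y ∩ treeCylEvent ∅ ↑F₁ y)
        * μ (treeCylEvent ↑S (edgeBallL r u (i :: u) ∩ A) y ∩ treeCylEvent ∅ ↑F₂ y)

/-- A random colored tree is `r`-Markov if the above holds with ambient set everything. -/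
def rMarkovTree [MeasurableSpace M] (r : ℕ) (μ : Measure (RCG M)) : Prop :=
  rMarkovTreeOn r Set.univ μ

/-- A random colored tree is vertex-Markov on the ambient set `A` if, conditioned on the tree
and on the value at a vertex, the processes on the pending subtrees of that vertex are
independent. -/
def vertexMarkovTreeOn [MeasurableSpace M] (A : Set (List ℕ)) (μ : Measure (RCG M)) :
    Prop :=
  ∀ v ∈ A, ∀ (k : ℕ) (u : Fin k → List ℕ), Function.Injective u →
    (∀ j, u j ∈ A ∧ ((∃ i, 1 ≤ i ∧ u j = i :: v) ∨ (v ≠ [] ∧ u j = v.tail))) →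
    ∀ F : Fin k → Finset (List ℕ), (∀ j, ↑(F j) ⊆ sideL (u j) v ∩ A) →
    ∀ S : Finset (List ℕ), ↑S ⊆ A → ∀ y : RCG M,
      μ (treeCylEvent ↑S {v} y ∩ ⋂ j, treeCylEvent ∅ ↑(F j) y)
          * (μ (treeCylEvent ↑S {v} y)) ^ (k - 1)
        = ∏ j : Fin k, μ (treeCylEvent ↑S {v} y ∩ treeCylEvent ∅ ↑(F j) y)

/-- A random colored tree is vertex-Markov if the above holds with ambient set everything. -/
def vertexMarkovTree [MeasurableSpace M] (μ : Measure (RCG M)) : Prop :=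
  vertexMarkovTreeOn Set.univ μ

/-! ### Random graphs with given degree sequences -/

/-- The set of simple graphs on `{1,…,n}` with degree sequence `dn`. -/
def degSeqGraphs (n : ℕ) (dn : Fin n → ℕ) : Set (SimpleGraph (Fin n)) :=
  {G | ∀ v, (G.neighborSet v).ncard = dn v}

/-- The probability that a uniform random graph with degree sequence `dn` lies in `A`. -/
def PrD (n : ℕ) (dn : Fin n → ℕ) (A : Set (SimpleGraph (Fin n))) : ℝ :=
  ((degSeqGraphs n dn ∩ A).ncard : ℝ) / ((degSeqGraphs n dn).ncard : ℝ)

/-- `𝓕_G(μ,r,ε)` for a process `μ` over a unimodular Galton-Watson tree. -/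
def FSetD [MeasurableSpace M] (μ : Measure (RCG M)) (r : ℕ) (ε : ℝ) {n : ℕ}
    (G : SimpleGraph (Fin n)) : Set (Fin n → M) :=
  {f | levyProkhorovDist ((distrG G f).map (resS r)) (μ.map (resS r)) ≤ ε}

/-- `H_G(μ,r,ε) = (1/n) log |𝓕_G(μ,r,ε)|`. -/
def HGD [MeasurableSpace M] (μ : Measure (RCG M)) (r : ℕ) (ε : ℝ) {n : ℕ}
    (G : SimpleGraph (Fin n)) : EReal :=
  if FSetD μ r ε G = ∅ then ⊥
  else ((Real.log ((FSetD μ r ε G).ncard) / n : ℝ) : EReal)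

/-- The `α`-quantile of `H_{G_n}(μ,r,ε)` for the uniform random graph with degree sequence
`DN n`. -/
def hquantD [MeasurableSpace M] (DN : (n : ℕ) → Fin n → ℕ) (μ : Measure (RCG M)) (r : ℕ)
    (ε : ℝ) (α : ℝ) (n : ℕ) : EReal :=
  sSup {h : EReal | (h = ⊥ ∨ 0 ≤ h) ∧
    α ≤ PrD n (DN n) {G : SimpleGraph (Fin n) | h ≤ HGD μ r ε G}}

/-- `h̄(μ,r,α)` for the degree-sequence ensemble. -/
def hbarAD [MeasurableSpace M] (DN : (n : ℕ) → Fin n → ℕ) (μ : Measure (RCG M)) (r : ℕ)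
    (α : ℝ) : EReal :=
  ⨅ ε : {e : ℝ // 0 < e}, Filter.atTop.limsup (fun n => hquantD DN μ r ε.1 α n)

/-- `h̲(μ,r,α)` for the degree-sequence ensemble. -/
def hlowAD [MeasurableSpace M] (DN : (n : ℕ) → Fin n → ℕ) (μ : Measure (RCG M)) (r : ℕ)
    (α : ℝ) : EReal :=
  ⨅ ε : {e : ℝ // 0 < e}, Filter.atTop.liminf (fun n => hquantD DN μ r ε.1 α n)

/-- `h̄(μ,r)`: the common value of `h̄(μ,r,α)`, `0 < α < 1`. -/
def hbarRD [MeasurableSpace M] (DN : (n : ℕ) → Fin n → ℕ) (μ : Measure (RCG M)) (r : ℕ) :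
    EReal :=
  hbarAD DN μ r (1 / 2)

/-- `h̲(μ,r)`. -/
def hlowRD [MeasurableSpace M] (DN : (n : ℕ) → Fin n → ℕ) (μ : Measure (RCG M)) (r : ℕ) :
    EReal :=
  hlowAD DN μ r (1 / 2)

/-- The upper sofic entropy `h̄(μ) = lim_{r → ∞} h̄(μ,r)`. -/
def hbarD [MeasurableSpace M] (DN : (n : ℕ) → Fin n → ℕ) (μ : Measure (RCG M)) : EReal :=
  ⨅ r : ℕ, hbarRD DN μ r

/-- The lower sofic entropy `h̲(μ) = lim_{r → ∞} h̲(μ,r)`. -/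
def hlowD [MeasurableSpace M] (DN : (n : ℕ) → Fin n → ℕ) (μ : Measure (RCG M)) : EReal :=
  ⨅ r : ℕ, hlowRD DN μ r

/-- The hypotheses on the degree sequences: uniformly bounded by `Δ`, even sums, and
empirical distributions converging (weakly) to `π`. -/
def GoodDegSeq (π : ℕ → ℝ) (Δ : ℝ) (DN : (n : ℕ) → Fin n → ℕ) : Prop :=
  (∀ n v, (DN n v : ℝ) ≤ Δ) ∧ (∀ n, Even (∑ v : Fin n, DN n v)) ∧
  (∀ k : ℕ, Tendsto (fun n => (((Finset.univ.filter (fun v : Fin n => DN n v = k)).card : ℝ) / n))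
    atTop (nhds (π k)))

/-- The hypotheses on the degree distribution `π`: a probability mass function supported in
`{0,…,Δ}` with mean `dd > 0`. -/
def GoodPmf (π : ℕ → ℝ) (Δ : ℝ) (dd : ℝ) : Prop :=
  (∀ k, 0 ≤ π k) ∧ (∑' k : ℕ, π k) = 1 ∧ (∀ k : ℕ, (Δ : ℝ) < k → π k = 0) ∧
  (∑' k : ℕ, (k : ℝ) * π k) = dd ∧ 0 < dd


/-! ### Couplings -/

/-- `ν ∈ I_d(M × M)` is an invariant coupling of `μ` with itself: both coordinate marginal
processes of `ν` have law `μ`. -/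
def IsInvCoupling (d : ℕ) {M : Type*} [MeasurableSpace M] (μ : Measure (TdVertex d → M))
    (ν : Measure (TdVertex d → M × M)) : Prop :=
  ν ∈ InvMeas d (M × M) ∧ ν.map (fun x => fun v => (x v).1) = μ ∧
    ν.map (fun x => fun v => (x v).2) = μ

/-- The first coordinate marginal of a colored graph with colors in a product set. -/
def rcgFst {M₁ M₂ : Type*} (g : RCG (M₁ × M₂)) : RCG M₁ :=
  ⟨fun l => (g.col l).map Prod.fst, g.adj⟩

/-- The second coordinate marginal of a colored graph with colors in a product set. -/
def rcgSnd {M₁ M₂ : Type*} (g : RCG (M₁ × M₂)) : RCG M₂ :=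
  ⟨fun l => (g.col l).map Prod.snd, g.adj⟩

/-- `ν ∈ I_π(M × M)` is an invariant coupling of `μ ∈ I_π(M)` with itself. -/
def IsInvCouplingUGW (π : ℕ → ℝ) (dd : ℝ) {M : Type*} [MeasurableSpace M]
    (μ : Measure (RCG M)) (ν : Measure (RCG (M × M))) : Prop :=
  ν ∈ IPiMeas π dd (M × M) ∧ ν.map rcgFst = μ ∧ ν.map rcgSnd = μ


/-! ### Concentration for functions of a uniform permutation -/

/-- Hoeffding's lemma for a uniform variable on a finite type. -/
lemma sum_exp_sub_mean_le {ι : Type*} [Fintype ι] [Nonempty ι] (m : ι → ℝ) (b l : ℝ)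
    (hb : ∀ p q, |m p - m q| ≤ b) :
    ∑ p, Real.exp (l * (m p - (∑ q, m q) / Fintype.card ι))
      ≤ Fintype.card ι * Real.exp (l ^ 2 * b ^ 2 / 2) := by
  set k : ℝ := (Fintype.card ι : ℝ) with hk
  have hk0 : 0 < k := by rw [hk]; exact_mod_cast Fintype.card_pos
  have jensen : ∀ p, Real.exp (l * (m p - (∑ q, m q) / k))
      ≤ ∑ q, k⁻¹ * Real.exp (l * (m p - m q)) := by
    intro p
    have h := convexOn_exp.map_sum_le (t := Finset.univ) (w := fun _ : ι => k⁻¹)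
      (p := fun q => l * (m p - m q)) (fun _ _ => by positivity)
      (by simp [← hk, hk0.ne']) (fun _ _ => Set.mem_univ _)
    simp only [smul_eq_mul] at h
    refine le_of_eq_of_le (congrArg Real.exp ?_) h
    rw [← Finset.mul_sum, ← Finset.mul_sum, Finset.sum_sub_distrib]
    simp only [Finset.sum_const, Finset.card_univ, nsmul_eq_mul, ← hk]
    field_simp
  have hcosh : ∀ p q, Real.exp (l * (m p - m q)) + Real.exp (l * (m q - m p))
      ≤ 2 * Real.exp (l ^ 2 * b ^ 2 / 2) := by
    intro p q
    have h1 : Real.exp (l * (m p - m q)) + Real.exp (l * (m q - m p))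
        = 2 * Real.cosh (l * (m p - m q)) := by
      rw [Real.cosh_eq]
      ring_nf
    rw [h1]
    refine mul_le_mul_of_nonneg_left ((Real.cosh_le_exp_half_sq _).trans ?_) (by norm_num)
    apply Real.exp_le_exp.2
    have h2 : (m p - m q) ^ 2 ≤ b ^ 2 := sq_le_sq' (by linarith [abs_le.1 (hb p q)])
      (abs_le.1 (hb p q)).2
    rw [mul_pow]
    have := mul_le_mul_of_nonneg_left h2 (sq_nonneg l)
    linarith
  have hsymm : ∑ p, ∑ q, Real.exp (l * (m p - m q)) = ∑ p, ∑ q, Real.exp (l * (m q - m p)) :=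
    Finset.sum_comm
  have hdouble : 2 * ∑ p, ∑ q, Real.exp (l * (m p - m q))
      ≤ k * (k * (2 * Real.exp (l ^ 2 * b ^ 2 / 2))) := by
    calc 2 * ∑ p, ∑ q, Real.exp (l * (m p - m q))
        = ∑ p, ∑ q, (Real.exp (l * (m p - m q)) + Real.exp (l * (m q - m p))) := by
          simp only [Finset.sum_add_distrib]
          rw [← hsymm]
          ring
      _ ≤ ∑ _p : ι, ∑ _q : ι, 2 * Real.exp (l ^ 2 * b ^ 2 / 2) :=
          Finset.sum_le_sum fun p _ => Finset.sum_le_sum fun q _ => hcosh p q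
      _ = _ := by simp [← hk]
  calc ∑ p, Real.exp (l * (m p - (∑ q, m q) / k))
      ≤ ∑ p, ∑ q, k⁻¹ * Real.exp (l * (m p - m q)) := Finset.sum_le_sum fun p _ => jensen p
    _ = k⁻¹ * ∑ p, ∑ q, Real.exp (l * (m p - m q)) := by
        simp only [Finset.mul_sum]
    _ ≤ k⁻¹ * (k * (k * Real.exp (l ^ 2 * b ^ 2 / 2))) := by
        refine mul_le_mul_of_nonneg_left ?_ (by positivity)
        linarith
    _ = k * Real.exp (l ^ 2 * b ^ 2 / 2) := by field_simp

/-- `f` changes by at most `c` when its argument is multiplied on the left by a transposition. -/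
def SwapLipschitz {α : Type*} [DecidableEq α] (c : ℝ) (f : Equiv.Perm α → ℝ) : Prop :=
  ∀ i j σ, |f (Equiv.swap i j * σ) - f σ| ≤ c

lemma decomposeFin_symm_eq_swap_mul {N : ℕ} (p : Fin (N + 1)) (e : Equiv.Perm (Fin N)) :
    Equiv.Perm.decomposeFin.symm (p, e)
      = Equiv.swap 0 p * Equiv.Perm.decomposeFin.symm (0, e) := by
  ext x
  refine Fin.cases ?_ (fun i => ?_) x <;> simp

lemma decomposeFin_symm_swap_mul {N : ℕ} (p : Fin (N + 1)) (i j : Fin N)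
    (e : Equiv.Perm (Fin N)) :
    ∃ a b, Equiv.Perm.decomposeFin.symm (p, Equiv.swap i j * e)
      = Equiv.swap a b * Equiv.Perm.decomposeFin.symm (p, e) := by
  have h0 : Equiv.Perm.decomposeFin.symm ((0 : Fin (N + 1)), Equiv.swap i j * e)
      = Equiv.swap i.succ j.succ * Equiv.Perm.decomposeFin.symm (0, e) := by
    ext x
    refine Fin.cases ?_ (fun k => ?_) x
    · simp [Equiv.swap_apply_of_ne_of_ne, (Fin.succ_ne_zero _).symm]
    · simp only [Equiv.Perm.decomposeFin_symm_apply_succ, Equiv.Perm.mul_apply, Equiv.swap_self,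
        Equiv.refl_apply]
      rw [← (Fin.succ_injective N).swap_apply]
  refine ⟨Equiv.swap 0 p i.succ, Equiv.swap 0 p j.succ, ?_⟩
  rw [decomposeFin_symm_eq_swap_mul, h0, decomposeFin_symm_eq_swap_mul p e, ← mul_assoc,
    ← mul_assoc, Equiv.mul_swap_eq_swap_mul]

lemma sum_exp_sub_mean_le_of_swapLipschitz_fin {c : ℝ} (l : ℝ) :
    ∀ {N : ℕ} (f : Equiv.Perm (Fin N) → ℝ), SwapLipschitz c f →
      ∑ σ, Real.exp (l * (f σ - (∑ τ, f τ) / (N.factorial : ℝ)))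
        ≤ N.factorial * Real.exp (2 * l ^ 2 * c ^ 2 * N)
  | 0, f, _ => by simp
  | N + 1, f, hf => by
    set m : Fin (N + 1) → ℝ := fun p =>
      (∑ e, f (Equiv.Perm.decomposeFin.symm (p, e))) / (N.factorial : ℝ) with hm
    have hN : (0 : ℝ) < N.factorial := by exact_mod_cast N.factorial_pos
    have hsum : ∀ F : Equiv.Perm (Fin (N + 1)) → ℝ,
        ∑ σ, F σ = ∑ p, ∑ e, F (Equiv.Perm.decomposeFin.symm (p, e)) := by
      intro F
      rw [← Equiv.sum_comp Equiv.Perm.decomposeFin.symm F, Fintype.sum_prod_type]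
    have hmean : (∑ τ, f τ) / ((N + 1).factorial : ℝ)
        = (∑ q, m q) / Fintype.card (Fin (N + 1)) := by
      rw [hsum, hm, ← Finset.sum_div, Nat.factorial_succ, Fintype.card_fin, div_div]
      push_cast
      rw [mul_comm]
    have hosc : ∀ p q, |m p - m q| ≤ 2 * c := by
      intro p q
      rw [hm]
      simp only
      rw [← sub_div, ← Finset.sum_sub_distrib, abs_div, abs_of_pos hN, div_le_iff₀ hN]
      refine (Finset.abs_sum_le_sum_abs _ _).trans ?_
      refine (Finset.sum_le_sum (g := fun _ => 2 * c) fun e _ => ?_).trans ?_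
      · rw [decomposeFin_symm_eq_swap_mul p, decomposeFin_symm_eq_swap_mul q]
        have h1 := abs_le.1 (hf 0 p (Equiv.Perm.decomposeFin.symm (0, e)))
        have h2 := abs_le.1 (hf 0 q (Equiv.Perm.decomposeFin.symm (0, e)))
        rw [abs_le]
        constructor <;> linarith [h1.1, h1.2, h2.1, h2.2]
      · simp [Fintype.card_perm, mul_comm]
    have hin : ∀ p, ∑ e, Real.exp (l * (f (Equiv.Perm.decomposeFin.symm (p, e)) - m p))
        ≤ N.factorial * Real.exp (2 * l ^ 2 * c ^ 2 * N) := by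
      intro p
      refine sum_exp_sub_mean_le_of_swapLipschitz_fin l
        (fun e => f (Equiv.Perm.decomposeFin.symm (p, e))) ?_
      intro i j e
      obtain ⟨a, b, hab⟩ := decomposeFin_symm_swap_mul p i j e
      simp only [hab]
      exact hf a b _
    rw [hsum]
    calc ∑ p, ∑ e, Real.exp (l * (f (Equiv.Perm.decomposeFin.symm (p, e))
            - (∑ τ, f τ) / ((N + 1).factorial : ℝ)))
        = ∑ p, Real.exp (l * (m p - (∑ q, m q) / Fintype.card (Fin (N + 1)))) *
            ∑ e, Real.exp (l * (f (Equiv.Perm.decomposeFin.symm (p, e)) - m p)) := by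
          refine Finset.sum_congr rfl fun p _ => ?_
          rw [Finset.mul_sum]
          refine Finset.sum_congr rfl fun e _ => ?_
          rw [← Real.exp_add, hmean]
          congr 1
          ring
      _ ≤ ∑ p, Real.exp (l * (m p - (∑ q, m q) / Fintype.card (Fin (N + 1)))) *
            (N.factorial * Real.exp (2 * l ^ 2 * c ^ 2 * N)) :=
          Finset.sum_le_sum fun p _ => mul_le_mul_of_nonneg_left (hin p) (Real.exp_pos _).le
      _ ≤ (Fintype.card (Fin (N + 1)) * Real.exp (l ^ 2 * (2 * c) ^ 2 / 2)) *
            (N.factorial * Real.exp (2 * l ^ 2 * c ^ 2 * N)) := by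
          rw [← Finset.sum_mul]
          exact mul_le_mul_of_nonneg_right (sum_exp_sub_mean_le m _ l hosc) (by positivity)
      _ = (N + 1).factorial * Real.exp (2 * l ^ 2 * c ^ 2 * (N + 1 : ℕ)) := by
          rw [Nat.factorial_succ, Fintype.card_fin]
          push_cast
          rw [show 2 * l ^ 2 * c ^ 2 * ((N : ℝ) + 1)
            = l ^ 2 * (2 * c) ^ 2 / 2 + 2 * l ^ 2 * c ^ 2 * N by ring, Real.exp_add]
          ring

lemma sum_exp_sub_mean_le_of_swapLipschitz {α : Type*} [Fintype α] [DecidableEq α] {c : ℝ} (l : ℝ)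
    (f : Equiv.Perm α → ℝ) (hf : SwapLipschitz c f) :
    ∑ σ, Real.exp (l * (f σ - (∑ τ, f τ) / ((Fintype.card α).factorial : ℝ)))
      ≤ (Fintype.card α).factorial * Real.exp (2 * l ^ 2 * c ^ 2 * Fintype.card α) := by
  let e : Equiv.Perm (Fin (Fintype.card α)) ≃ Equiv.Perm α :=
    (Fintype.equivFin α).symm.permCongr
  have hg : SwapLipschitz c (fun σ => f (e σ)) := by
    intro i j σ
    have : e (Equiv.swap i j * σ)
        = Equiv.swap ((Fintype.equivFin α).symm i) ((Fintype.equivFin α).symm j) * e σ := by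
      ext x
      simp [e, Equiv.permCongr_apply, (Fintype.equivFin α).symm.injective.swap_apply]
    simp only [this]
    exact hf _ _ _
  have h := sum_exp_sub_mean_le_of_swapLipschitz_fin l _ hg
  rw [Equiv.sum_comp e f,
    Equiv.sum_comp e (fun σ => Real.exp (l * (f σ - (∑ τ, f τ) / _)))] at h
  exact h

lemma exists_card_swapLipschitz_tail_le {α : Type*} [Fintype α] [DecidableEq α] {c : ℝ}
    (f : Equiv.Perm α → ℝ) (hf : SwapLipschitz c f) :
    ∃ s : ℝ, ∀ t : ℝ, 0 < t →
      ((Finset.univ.filter fun σ => t ≤ |f σ - s|).card : ℝ)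
        ≤ (Fintype.card α).factorial *
          (2 * Real.exp (-t ^ 2 / (8 * c ^ 2 * Fintype.card α))) := by
  refine ⟨(∑ τ, f τ) / ((Fintype.card α).factorial : ℝ), fun t ht => ?_⟩
  set s := (∑ τ, f τ) / ((Fintype.card α).factorial : ℝ) with hs
  set N : ℝ := (Fintype.card α : ℝ) with hN
  set F : ℝ := ((Fintype.card α).factorial : ℝ) with hF
  have hF0 : 0 < F := by rw [hF]; exact_mod_cast Nat.factorial_pos _
  have htail : ∀ l : ℝ, 0 ≤ l →
      ((Finset.univ.filter fun σ => t ≤ |f σ - s|).card : ℝ)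
        ≤ F * (2 * Real.exp (2 * l ^ 2 * c ^ 2 * N - l * t)) := by
    intro l hl
    have h1 := sum_exp_sub_mean_le_of_swapLipschitz l f hf
    have h2 := sum_exp_sub_mean_le_of_swapLipschitz (-l) f hf
    rw [← hs, ← hN, ← hF] at h1 h2
    rw [neg_sq] at h2
    have h3 : ((Finset.univ.filter fun σ => t ≤ |f σ - s|).card : ℝ) * Real.exp (l * t)
        ≤ ∑ σ, (Real.exp (l * (f σ - s)) + Real.exp (-l * (f σ - s))) := by
      rw [← nsmul_eq_mul, ← Finset.sum_const]
      refine (Finset.sum_le_sum fun σ hσ => ?_).trans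
        (Finset.sum_le_univ_sum_of_nonneg fun σ => by positivity)
      have hσ' := (Finset.mem_filter.1 hσ).2
      rcases le_abs.1 hσ' with h | h
      · have := Real.exp_le_exp.2 (mul_le_mul_of_nonneg_left h hl)
        have h' := Real.exp_pos (-l * (f σ - s))
        linarith
      · have := Real.exp_le_exp.2 (mul_le_mul_of_nonneg_left h hl)
        have h' := Real.exp_pos (l * (f σ - s))
        rw [mul_neg, ← neg_mul] at this
        linarith
    rw [Finset.sum_add_distrib] at h3
    rw [Real.exp_sub, ← mul_div_assoc, ← mul_div_assoc, le_div_iff₀ (Real.exp_pos _)]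
    linarith
  rcases eq_or_ne (c ^ 2 * N) 0 with h0 | h0
  · have := htail 0 le_rfl
    rw [mul_assoc 8, h0]
    simpa using this
  · have hpos : 0 < c ^ 2 * N := lt_of_le_of_ne (by positivity) h0.symm
    have := htail (t / (4 * (c ^ 2 * N))) (by positivity)
    convert this using 4
    have hc : c ≠ 0 := by rintro rfl; simp at h0
    have hN' : N ≠ 0 := by intro h; simp [h] at h0
    field_simp
    ring

/-! ### Random pairings of half-edges -/

/-- A perfect matching of `α`, given as a fixed-point-free involution. -/
def IsPairing {α : Type*} (p : Equiv.Perm α) : Prop :=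
  (∀ h, p (p h) = h) ∧ ∀ h, p h ≠ h

/-- The conjugate of `J` by `σ`; for `J` a pairing and `σ` uniform it is a uniform pairing. -/
def conjPerm {α : Type*} (J σ : Equiv.Perm α) : Equiv.Perm α := σ * J * σ⁻¹

section Conj

variable {α : Type*} {J : Equiv.Perm α}

lemma IsPairing.conjPerm (hJ : IsPairing J) (σ : Equiv.Perm α) :
    IsPairing (conjPerm J σ) := by
  refine ⟨fun h => by simp [TreeEntropy.conjPerm, hJ.1], fun h hh => hJ.2 (σ⁻¹ h) ?_⟩
  rw [TreeEntropy.conjPerm, Equiv.Perm.mul_apply, Equiv.Perm.mul_apply] at hh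
  rw [Equiv.Perm.eq_inv_iff_eq, hh]

lemma conjPerm_mul (J τ σ : Equiv.Perm α) :
    conjPerm J (τ * σ) = τ * conjPerm J σ * τ⁻¹ := by
  simp [conjPerm, mul_assoc]

variable [DecidableEq α]

lemma conjPerm_swap_mul_apply (J σ : Equiv.Perm α) (x y h : α) :
    conjPerm J (Equiv.swap x y * σ) h
      = Equiv.swap x y (conjPerm J σ (Equiv.swap x y h)) := by
  simp [conjPerm_mul]

variable [Fintype α]

lemma card_conjPerm_eq_mul_le {h k : α} (hk : h ≠ k) :
    (Fintype.card α - 1) * (Finset.univ.filter fun σ => conjPerm J σ h = k).card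
      ≤ (Fintype.card α).factorial := by
  have hswap : ∀ k', k' ≠ h →
      (Finset.univ.filter fun σ => conjPerm J σ h = k).card
        ≤ (Finset.univ.filter fun σ => conjPerm J σ h = k').card := by
    intro k' hk'
    refine Finset.card_le_card_of_injOn (fun σ => Equiv.swap k k' * σ) ?_
      (fun _ _ _ _ hh => mul_left_cancel hh)
    intro σ hσ
    simp only [Finset.coe_filter, Finset.mem_univ, true_and, Set.mem_ofPred_eq] at hσ ⊢
    rw [conjPerm_swap_mul_apply, Equiv.swap_apply_of_ne_of_ne hk hk'.symm, hσ,
      Equiv.swap_apply_left]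
  calc (Fintype.card α - 1) * (Finset.univ.filter fun σ => conjPerm J σ h = k).card
      = ∑ _k' ∈ Finset.univ.erase h,
          (Finset.univ.filter fun σ => conjPerm J σ h = k).card := by
        rw [Finset.sum_const, Finset.card_erase_of_mem (Finset.mem_univ _), Finset.card_univ,
          smul_eq_mul]
    _ ≤ ∑ k' ∈ Finset.univ.erase h,
          (Finset.univ.filter fun σ => conjPerm J σ h = k').card :=
        Finset.sum_le_sum fun k' hk' => hswap k' (Finset.ne_of_mem_erase hk')
    _ ≤ ∑ k', (Finset.univ.filter fun σ => conjPerm J σ h = k').card :=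
        Finset.sum_le_sum_of_subset (Finset.subset_univ _)
    _ = (Fintype.card α).factorial := by
        rw [← Fintype.card_perm, ← Finset.card_univ]
        exact (Finset.card_eq_sum_card_fiberwise fun _ _ => Finset.mem_univ _).symm

lemma card_conjPerm_eq_eq_mul_le {h k h' k' : α} (hk : h ≠ k)
    (hh' : h' ≠ h) (hk' : k' ≠ h') (hhk : k' ≠ h) (hkk : k' ≠ k) (hk2 : k ≠ h') :
    (Fintype.card α - 1) * (Fintype.card α - 3) *
        (Finset.univ.filter fun σ => conjPerm J σ h = k ∧ conjPerm J σ h' = k').card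
      ≤ (Fintype.card α).factorial := by
  refine le_trans ?_ (card_conjPerm_eq_mul_le (J := J) hk)
  rw [mul_assoc]
  refine Nat.mul_le_mul_left _ ?_
  have hswap : ∀ l, l ≠ h → l ≠ k → l ≠ h' →
      (Finset.univ.filter fun σ => conjPerm J σ h = k ∧ conjPerm J σ h' = k').card
        ≤ (Finset.univ.filter fun σ => conjPerm J σ h = k ∧ conjPerm J σ h' = l).card := by
    intro l h1 h2 h3
    refine Finset.card_le_card_of_injOn (fun σ => Equiv.swap k' l * σ) ?_
      (fun _ _ _ _ hh => mul_left_cancel hh)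
    intro σ hσ
    simp only [Finset.coe_filter, Finset.mem_univ, true_and, Set.mem_ofPred_eq] at hσ ⊢
    rw [conjPerm_swap_mul_apply, conjPerm_swap_mul_apply,
      Equiv.swap_apply_of_ne_of_ne hhk.symm h1.symm, hσ.1,
      Equiv.swap_apply_of_ne_of_ne hkk.symm h2.symm,
      Equiv.swap_apply_of_ne_of_ne hk'.symm h3.symm, hσ.2, Equiv.swap_apply_left]
    exact ⟨rfl, rfl⟩
  calc (Fintype.card α - 3) *
        (Finset.univ.filter fun σ => conjPerm J σ h = k ∧ conjPerm J σ h' = k').card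
      = ∑ _l ∈ Finset.univ \ {h, k, h'},
          (Finset.univ.filter fun σ => conjPerm J σ h = k ∧ conjPerm J σ h' = k').card := by
        rw [Finset.sum_const, Finset.card_sdiff_of_subset (Finset.subset_univ _),
          Finset.card_univ, smul_eq_mul, Finset.card_eq_three.2 ⟨h, k, h', hk, hh'.symm, hk2, rfl⟩]
    _ ≤ ∑ l ∈ Finset.univ \ {h, k, h'},
          (Finset.univ.filter fun σ => conjPerm J σ h = k ∧ conjPerm J σ h' = l).card := by
        refine Finset.sum_le_sum fun l hl => ?_
        simp only [Finset.mem_sdiff, Finset.mem_univ, true_and, Finset.mem_insert,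
          Finset.mem_singleton, not_or] at hl
        exact hswap l hl.1 hl.2.1 hl.2.2
    _ ≤ ∑ l, (Finset.univ.filter fun σ => conjPerm J σ h = k ∧ conjPerm J σ h' = l).card :=
        Finset.sum_le_sum_of_subset (Finset.subset_univ _)
    _ = (Finset.univ.filter fun σ => conjPerm J σ h = k).card := by
        rw [Finset.card_eq_sum_card_fiberwise
          (f := fun σ => conjPerm J σ h') (t := Finset.univ) fun _ _ => Finset.mem_univ _]
        simp only [Finset.filter_filter]

end Conj

section Clashes

variable {n d : ℕ}

/-- The pairs of distinct half-edges of a common vertex which a pairing `p` matches to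
half-edges of a common vertex. They come from the loops and the multiple edges of the
multigraph obtained from `p`. -/
def clashes (p : Equiv.Perm (Fin n × Fin d)) :
    Finset ((Fin n × Fin d) × (Fin n × Fin d)) :=
  Finset.univ.filter fun q => q.1 ≠ q.2 ∧ q.1.1 = q.2.1 ∧ (p q.1).1 = (p q.2).1

lemma mem_clashes {p : Equiv.Perm (Fin n × Fin d)} {a b : Fin n × Fin d} :
    (a, b) ∈ clashes p ↔ a ≠ b ∧ a.1 = b.1 ∧ (p a).1 = (p b).1 := by
  simp [clashes]

/-- The closed neighborhood of `v` in the multigraph obtained from the pairing `p`. -/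
def closedNbhd (p : Equiv.Perm (Fin n × Fin d)) (v : Fin n) : Finset (Fin n) :=
  insert v (Finset.univ.image fun i => (p (v, i)).1)

lemma self_mem_closedNbhd (p : Equiv.Perm (Fin n × Fin d)) (v : Fin n) :
    v ∈ closedNbhd p v :=
  Finset.mem_insert_self _ _

lemma mem_closedNbhd (p : Equiv.Perm (Fin n × Fin d)) (h : Fin n × Fin d) :
    (p h).1 ∈ closedNbhd p h.1 :=
  Finset.mem_insert_of_mem (Finset.mem_image.2 ⟨h.2, Finset.mem_univ _, rfl⟩)

lemma card_closedNbhd_le (p : Equiv.Perm (Fin n × Fin d)) (v : Fin n) :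
    (closedNbhd p v).card ≤ d + 1 := by
  refine (Finset.card_insert_le _ _).trans (Nat.succ_le_succ ?_)
  exact Finset.card_image_le.trans (by simp)

/-- The half-edges `y` such that replacing the edges `{x, p x}` and `{y, p y}` by `{x, p y}` and
`{y, p x}` creates no new clash. -/
def goodSwitches (p : Equiv.Perm (Fin n × Fin d)) (x : Fin n × Fin d) :
    Finset (Fin n × Fin d) :=
  Finset.univ.filter fun y =>
    y.1 ∉ closedNbhd p (p x).1 ∧ (p y).1 ∉ closedNbhd p x.1 ∧ y.1 ≠ (p y).1

lemma card_le_card_goodSwitches_add {p : Equiv.Perm (Fin n × Fin d)} (hp : IsPairing p)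
    (x : Fin n × Fin d) :
    n * d ≤ (goodSwitches p x).card + (2 * (d * (d + 1)) + (clashes p).card) := by
  have h1 : (Finset.univ.filter fun y : Fin n × Fin d => y.1 ∈ closedNbhd p (p x).1).card
      ≤ d * (d + 1) := by
    refine (Finset.card_le_card (t := closedNbhd p (p x).1 ×ˢ Finset.univ) ?_).trans ?_
    · intro y hy
      simpa using hy
    · rw [Finset.card_product, mul_comm, Finset.card_univ, Fintype.card_fin]
      exact Nat.mul_le_mul_left _ (card_closedNbhd_le _ _)
  have h2 : (Finset.univ.filter fun y : Fin n × Fin d => (p y).1 ∈ closedNbhd p x.1).card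
      ≤ d * (d + 1) := by
    refine (Finset.card_le_card_of_injOn (t := closedNbhd p x.1 ×ˢ Finset.univ) p ?_
      p.injective.injOn).trans ?_
    · intro y hy
      simpa using hy
    · rw [Finset.card_product, mul_comm, Finset.card_univ, Fintype.card_fin]
      exact Nat.mul_le_mul_left _ (card_closedNbhd_le _ _)
  have h3 : (Finset.univ.filter fun y : Fin n × Fin d => y.1 = (p y).1).card
      ≤ (clashes p).card := by
    refine Finset.card_le_card_of_injOn (fun y => (y, p y)) ?_
      (fun a _ b _ hab => congrArg Prod.fst hab)
    intro y hy
    simp only [Finset.coe_filter, Finset.mem_univ, true_and, Set.mem_ofPred_eq] at hy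
    simp only [Finset.mem_coe, mem_clashes]
    exact ⟨(hp.2 y).symm, hy, by rw [hp.1, hy]⟩
  have hcover : (Finset.univ : Finset (Fin n × Fin d)) ⊆ goodSwitches p x ∪
      ((Finset.univ.filter fun y : Fin n × Fin d => y.1 ∈ closedNbhd p (p x).1) ∪
      ((Finset.univ.filter fun y : Fin n × Fin d => (p y).1 ∈ closedNbhd p x.1) ∪
      (Finset.univ.filter fun y : Fin n × Fin d => y.1 = (p y).1))) := by
    intro y _
    simp only [goodSwitches, Finset.mem_union, Finset.mem_filter, Finset.mem_univ, true_and]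
    tauto
  have h4 := Finset.card_le_card hcover
  have h5 := Finset.card_union_le (goodSwitches p x)
    ((Finset.univ.filter fun y : Fin n × Fin d => y.1 ∈ closedNbhd p (p x).1) ∪
      ((Finset.univ.filter fun y : Fin n × Fin d => (p y).1 ∈ closedNbhd p x.1) ∪
      (Finset.univ.filter fun y : Fin n × Fin d => y.1 = (p y).1)))
  have h6 := Finset.card_union_le
    (Finset.univ.filter fun y : Fin n × Fin d => y.1 ∈ closedNbhd p (p x).1)
      ((Finset.univ.filter fun y : Fin n × Fin d => (p y).1 ∈ closedNbhd p x.1) ∪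
      (Finset.univ.filter fun y : Fin n × Fin d => y.1 = (p y).1))
  have h7 := Finset.card_union_le
    (Finset.univ.filter fun y : Fin n × Fin d => (p y).1 ∈ closedNbhd p x.1)
      (Finset.univ.filter fun y : Fin n × Fin d => y.1 = (p y).1)
  have h8 : (Finset.univ : Finset (Fin n × Fin d)).card = n * d := by simp
  linarith

section Switch

variable {p p' : Equiv.Perm (Fin n × Fin d)} {x y h' : Fin n × Fin d}

lemma goodSwitches_spec (hp : IsPairing p) (hy : y ∈ goodSwitches p x) :
    y.1 ≠ (p x).1 ∧ (p y).1 ≠ x.1 ∧ y.1 ≠ (p y).1 ∧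
      (∀ u, u.1 = (p x).1 → (p u).1 ≠ y.1) ∧ (∀ u, u.1 = x.1 → (p u).1 ≠ (p y).1) ∧
      (∀ u, u.1 = y.1 → (p u).1 ≠ (p x).1) ∧ (∀ u, u.1 = (p y).1 → (p u).1 ≠ x.1) := by
  obtain ⟨g1, g2, g3⟩ := (Finset.mem_filter.1 hy).2
  have n1 : ∀ u, u.1 = (p x).1 → (p u).1 ≠ y.1 := fun u hu h =>
    g1 (h ▸ hu ▸ mem_closedNbhd p u)
  have n2 : ∀ u, u.1 = x.1 → (p u).1 ≠ (p y).1 := fun u hu h =>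
    g2 (h ▸ hu ▸ mem_closedNbhd p u)
  exact ⟨fun h => g1 (h ▸ self_mem_closedNbhd p _), fun h => g2 (h ▸ self_mem_closedNbhd p _),
    g3, n1, n2, fun u hu h => n1 (p u) h ((congrArg Prod.fst (hp.1 u)).trans hu),
    fun u hu h => n2 (p u) h ((congrArg Prod.fst (hp.1 u)).trans hu)⟩

lemma switch_apply (hp : IsPairing p) (hy : y ∈ goodSwitches p x)
    (hp' : ∀ h, p' h = Equiv.swap x y (p (Equiv.swap x y h))) :
    p' x = p y ∧ p' y = p x ∧ p' (p x) = y ∧ p' (p y) = x ∧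
      ∀ u, u ≠ x → u ≠ y → u ≠ p x → u ≠ p y → p' u = p u := by
  obtain ⟨g1, g2, g3, n1, n2, n3, n4⟩ := goodSwitches_spec hp hy
  have hyx : y ≠ p x := fun h => g1 (h ▸ rfl)
  have hyx' : p y ≠ x := fun h => g2 (h ▸ rfl)
  have hpx := hp.2 x
  have hpy := hp.2 y
  refine ⟨?_, ?_, ?_, ?_, fun u h1 h2 h3 h4 => ?_⟩
  · rw [hp', Equiv.swap_apply_left, Equiv.swap_apply_of_ne_of_ne hyx' hpy]
  · rw [hp', Equiv.swap_apply_right, Equiv.swap_apply_of_ne_of_ne hpx hyx.symm]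
  · rw [hp', Equiv.swap_apply_of_ne_of_ne hpx hyx.symm, hp.1, Equiv.swap_apply_left]
  · rw [hp', Equiv.swap_apply_of_ne_of_ne hyx' hpy, hp.1, Equiv.swap_apply_right]
  · rw [hp', Equiv.swap_apply_of_ne_of_ne h1 h2, Equiv.swap_apply_of_ne_of_ne]
    · rintro rfl; exact h3 (hp.1 u).symm
    · rintro rfl; exact h4 (hp.1 u).symm

lemma clashes_switch_aux (hp : IsPairing p) (hy : y ∈ goodSwitches p x)
    (hp' : ∀ h, p' h = Equiv.swap x y (p (Equiv.swap x y h)))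
    {u u' : Fin n × Fin d} (hu : (u, u') ∈ clashes p') :
    u ≠ x ∧ u ≠ y ∧ u ≠ p x ∧ u ≠ p y := by
  obtain ⟨g1, g2, g3, n1, n2, n3, n4⟩ := goodSwitches_spec hp hy
  obtain ⟨e1, e2, e3, e4, e5⟩ := switch_apply hp hy hp'
  obtain ⟨hne, hv, hpv⟩ := mem_clashes.1 hu
  have hcases : u' = x ∨ u' = y ∨ u' = p x ∨ u' = p y ∨ p' u' = p u' := by
    by_contra! hcon
    exact hcon.2.2.2.2 (e5 u' hcon.1 hcon.2.1 hcon.2.2.1 hcon.2.2.2.1)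
  refine ⟨?_, ?_, ?_, ?_⟩
  · intro hu
    rw [hu] at hne hv hpv
    rw [e1] at hpv
    rcases hcases with h | h | h | h | h <;> simp only [h] at hne hv hpv
    · exact hne rfl
    · exact n3 x hv rfl
    · exact g3 (e3 ▸ hpv.symm)
    · exact g2 hv.symm
    · exact n2 u' hv.symm hpv.symm
  · intro hu
    rw [hu] at hne hv hpv
    rw [e2] at hpv
    rcases hcases with h | h | h | h | h <;> simp only [h] at hne hv hpv
    · exact n3 x hv.symm rfl
    · exact hne rfl
    · exact g1 hv
    · exact g3 hv
    · exact n3 u' hv.symm hpv.symm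
  · intro hu
    rw [hu] at hne hv hpv
    rw [e3] at hpv
    rcases hcases with h | h | h | h | h <;> simp only [h] at hne hv hpv
    · exact g3 (e1 ▸ hpv)
    · exact g1 hv.symm
    · exact hne rfl
    · exact n2 x rfl hv
    · exact n1 u' hv.symm hpv.symm
  · intro hu
    rw [hu] at hne hv hpv
    rw [e4] at hpv
    rcases hcases with h | h | h | h | h <;> simp only [h] at hne hv hpv
    · exact g2 hv
    · exact g3 hv.symm
    · exact n2 x rfl hv.symm
    · exact hne rfl
    · exact n4 u' hv.symm hpv.symm

lemma clashes_switch_ssubset (hp : IsPairing p) (hx : (x, h') ∈ clashes p)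
    (hy : y ∈ goodSwitches p x)
    (hp' : ∀ h, p' h = Equiv.swap x y (p (Equiv.swap x y h))) :
    clashes p' ⊂ clashes p := by
  have hsym : ∀ {u u'}, (u, u') ∈ clashes p' → (u', u) ∈ clashes p' := by
    intro u u' h
    rw [mem_clashes] at h ⊢
    exact ⟨h.1.symm, h.2.1.symm, h.2.2.symm⟩
  have hfix := (switch_apply hp hy hp').2.2.2.2
  refine Finset.ssubset_iff_subset_ne.2 ⟨?_, ?_⟩
  · rintro ⟨u, u'⟩ hu
    obtain ⟨h1, h2, h3, h4⟩ := clashes_switch_aux hp hy hp' hu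
    obtain ⟨h1', h2', h3', h4'⟩ := clashes_switch_aux hp hy hp' (hsym hu)
    rw [mem_clashes] at hu ⊢
    rwa [hfix u h1 h2 h3 h4, hfix u' h1' h2' h3' h4'] at hu
  · intro h
    rw [← h] at hx
    exact (clashes_switch_aux hp hy hp' hx).1 rfl

/-- The half-edge used in a switching can be recovered from the switched pairing. -/
lemma eq_of_switch (hp : IsPairing p) (hx : (x, h') ∈ clashes p)
    (hy : y ∈ goodSwitches p x)
    (hp' : ∀ h, p' h = Equiv.swap x y (p (Equiv.swap x y h))) :
    y = if h' = p x then p' h' else p' ((p' h').1, (p x).2) := by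
  obtain ⟨g1, g2, g3, n1, n2, n3, n4⟩ := goodSwitches_spec hp hy
  obtain ⟨e1, e2, e3, e4, e5⟩ := switch_apply hp hy hp'
  obtain ⟨hne, hv, hpv⟩ := mem_clashes.1 hx
  split_ifs with h
  · rw [h, e3]
  · have h1 : h' ≠ y := by
      rintro rfl
      exact n3 x hv rfl
    have h2 : h' ≠ p y := by
      rintro rfl
      exact g2 hv.symm
    rw [e5 h' hne.symm h1 h h2, ← hpv, Prod.mk.eta, e3]

end Switch

section Counting

variable {J : Equiv.Perm (Fin n × Fin d)}

lemma card_clashes_eq_mul_le (hJ : IsPairing J) {b : ℕ} (hb : b ≠ 0) :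
    (n * d - (2 * (d * (d + 1)) + b)) *
        (Finset.univ.filter fun σ => (clashes (conjPerm J σ)).card = b).card
      ≤ n * d * (d * (d + 1)) *
        (Finset.univ.filter fun σ => (clashes (conjPerm J σ)).card < b).card := by
  set S := Finset.univ.filter fun σ => (clashes (conjPerm J σ)).card = b with hS
  set T := Finset.univ.filter fun σ => (clashes (conjPerm J σ)).card < b with hT
  rcases isEmpty_or_nonempty (Fin n × Fin d) with hemp | hnon
  · have : n * d = 0 := by
      have h := Fintype.card_eq_zero (α := Fin n × Fin d)
      rwa [Fintype.card_prod, Fintype.card_fin, Fintype.card_fin] at h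
    simp [this]
  have hne : ∀ σ, ∃ q, σ ∈ S → q ∈ clashes (conjPerm J σ) := by
    intro σ
    by_cases hσ : σ ∈ S
    · have : (clashes (conjPerm J σ)).Nonempty := by
        rw [← Finset.card_pos, (Finset.mem_filter.1 hσ).2]
        exact Nat.pos_of_ne_zero hb
      exact ⟨this.choose, fun _ => this.choose_spec⟩
    · exact ⟨(hnon.some, hnon.some), fun h => absurd h hσ⟩
  choose q hq using hne
  let P : Finset (Σ _ : Equiv.Perm (Fin n × Fin d), Fin n × Fin d) :=
    S.sigma fun σ => goodSwitches (conjPerm J σ) (q σ).1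
  have hP : (n * d - (2 * (d * (d + 1)) + b)) * S.card ≤ P.card := by
    rw [Finset.card_sigma, mul_comm, ← smul_eq_mul, ← Finset.sum_const]
    refine Finset.sum_le_sum fun σ hσ => ?_
    have := card_le_card_goodSwitches_add (hJ.conjPerm σ) (q σ).1
    rw [(Finset.mem_filter.1 hσ).2] at this
    exact Nat.sub_le_iff_le_add.2 this
  let code : (Σ _ : Equiv.Perm (Fin n × Fin d), Fin n × Fin d) →
      Equiv.Perm (Fin n × Fin d) × ((Fin n × Fin d) × (Fin d × Option (Fin d))) := fun z =>
    (Equiv.swap (q z.1).1 z.2 * z.1, (q z.1).1, (q z.1).2.2,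
      if (q z.1).2 = conjPerm J z.1 (q z.1).1 then none
      else some (conjPerm J z.1 (q z.1).1).2)
  have hcard : P.card ≤ (T ×ˢ (Finset.univ :
      Finset ((Fin n × Fin d) × (Fin d × Option (Fin d))))).card := by
    refine Finset.card_le_card_of_injOn code ?_ ?_
    · rintro ⟨σ, y⟩ hz
      obtain ⟨hσ, hy⟩ := Finset.mem_sigma.1 (Finset.mem_coe.1 hz)
      refine Finset.mem_coe.2 (Finset.mem_product.2 ⟨?_, Finset.mem_univ _⟩)
      have := Finset.card_lt_card (clashes_switch_ssubset (hJ.conjPerm σ) (hq σ hσ) hy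
        (conjPerm_swap_mul_apply J σ _ y))
      rw [(Finset.mem_filter.1 hσ).2] at this
      exact Finset.mem_filter.2 ⟨Finset.mem_univ _, this⟩
    · rintro ⟨σ, y⟩ hz ⟨σ', y'⟩ hz' hc
      obtain ⟨hσ, hy⟩ := Finset.mem_sigma.1 (Finset.mem_coe.1 hz)
      obtain ⟨hσ', hy'⟩ := Finset.mem_sigma.1 (Finset.mem_coe.1 hz')
      simp only at hσ hy hσ' hy'
      have h1 := eq_of_switch (hJ.conjPerm σ) (hq σ hσ) hy (conjPerm_swap_mul_apply J σ _ y)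
      have h1' := eq_of_switch (hJ.conjPerm σ') (hq σ' hσ') hy'
        (conjPerm_swap_mul_apply J σ' _ y')
      simp only [code, Prod.mk.injEq] at hc
      obtain ⟨c1, c2, c3, c4⟩ := hc
      have hv := (mem_clashes.1 (hq σ hσ)).2.1
      have hv' := (mem_clashes.1 (hq σ' hσ')).2.1
      have c5 : (q σ).2 = (q σ').2 := Prod.ext (by rw [← hv, ← hv', c2]) c3
      have hyy : y = y' := by
        rw [h1, h1', c1, c5]
        rw [c5] at c4
        split_ifs at c4 ⊢ with k1 k2
        · rfl
        · rw [Option.some.inj c4]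
      subst hyy
      rw [c2] at c1
      rw [mul_left_cancel c1]
  refine hP.trans (hcard.trans (le_of_eq ?_))
  rw [Finset.card_product, Finset.card_univ]
  simp only [Fintype.card_prod, Fintype.card_fin, Fintype.card_option]
  ring

lemma card_fst_eq_mul_le {J : Equiv.Perm (Fin n × Fin d)} (hJ : IsPairing J)
    {h h' : Fin n × Fin d} (hne : h ≠ h') :
    (n * d - 1) * (n * d - 3) *
        (Finset.univ.filter fun σ => (conjPerm J σ h).1 = (conjPerm J σ h').1).card
      ≤ (n * d - 3 + n * d * d) * (n * d).factorial := by
  have hN : Fintype.card (Fin n × Fin d) = n * d := by simp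
  set A : (Fin n × Fin d) × Fin d → Finset (Equiv.Perm (Fin n × Fin d)) := fun k =>
    Finset.univ.filter fun σ => (conjPerm J σ h = k.1 ∧ conjPerm J σ h' = (k.1.1, k.2)) ∧
      conjPerm J σ h ≠ h' with hA
  have hA1 : ∀ k, (n * d - 1) * (n * d - 3) * (A k).card ≤ (n * d).factorial := by
    rintro ⟨k, j⟩
    rcases (A (k, j)).eq_empty_or_nonempty with he | ⟨σ₀, hσ₀⟩
    · simp [he]
    · obtain ⟨⟨e1, e2⟩, e3⟩ := (Finset.mem_filter.1 hσ₀).2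
      simp only at e1 e2
      have hp := hJ.conjPerm σ₀
      rw [← hN]
      refine le_trans (Nat.mul_le_mul_left _ (Finset.card_le_card ?_))
        (card_conjPerm_eq_eq_mul_le (J := J) (h := h) (k := k) (h' := h') (k' := (k.1, j))
          ?_ hne.symm ?_ ?_ ?_ ?_)
      · intro σ hσ
        exact Finset.mem_filter.2 ⟨Finset.mem_univ _, (Finset.mem_filter.1 hσ).2.1⟩
      · rw [← e1]; exact (hp.2 h).symm
      · rw [← e2]; exact hp.2 h'
      · rw [← e2]
        intro hh
        exact e3 (by rw [← hh, hp.1])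
      · rw [← e2, ← e1]
        exact fun hh => hne ((conjPerm J σ₀).injective hh).symm
      · rw [← e1]; exact e3
  have hsub : (Finset.univ.filter fun σ => (conjPerm J σ h).1 = (conjPerm J σ h').1)
      ⊆ (Finset.univ.filter fun σ => conjPerm J σ h = h') ∪ Finset.univ.biUnion A := by
    intro σ hσ
    have hσ' := (Finset.mem_filter.1 hσ).2
    by_cases hc : conjPerm J σ h = h'
    · exact Finset.mem_union_left _ (Finset.mem_filter.2 ⟨Finset.mem_univ _, hc⟩)
    · refine Finset.mem_union_right _ (Finset.mem_biUnion.2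
        ⟨(conjPerm J σ h, (conjPerm J σ h').2), Finset.mem_univ _,
          Finset.mem_filter.2 ⟨Finset.mem_univ _, ⟨rfl, ?_⟩, hc⟩⟩)
      exact Prod.ext hσ'.symm rfl
  have h1 : (n * d - 1) * (Finset.univ.filter fun σ => conjPerm J σ h = h').card
      ≤ (n * d).factorial := hN ▸ card_conjPerm_eq_mul_le (J := J) hne
  calc (n * d - 1) * (n * d - 3) *
        (Finset.univ.filter fun σ => (conjPerm J σ h).1 = (conjPerm J σ h').1).card
      ≤ (n * d - 1) * (n * d - 3) *
        ((Finset.univ.filter fun σ => conjPerm J σ h = h').card + ∑ k, (A k).card) :=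
        Nat.mul_le_mul_left _ ((Finset.card_le_card hsub).trans
          ((Finset.card_union_le _ _).trans
            (Nat.add_le_add_left Finset.card_biUnion_le _)))
    _ = (n * d - 3) * ((n * d - 1) *
          (Finset.univ.filter fun σ => conjPerm J σ h = h').card)
        + ∑ k, (n * d - 1) * (n * d - 3) * (A k).card := by
        rw [mul_add, Finset.mul_sum]
        ring
    _ ≤ (n * d - 3) * (n * d).factorial
        + ∑ _k : (Fin n × Fin d) × Fin d, (n * d).factorial :=
        Nat.add_le_add (Nat.mul_le_mul_left _ h1) (Finset.sum_le_sum fun k _ => hA1 k)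
    _ = (n * d - 3 + n * d * d) * (n * d).factorial := by
        rw [Finset.sum_const, Finset.card_univ, smul_eq_mul]
        simp only [Fintype.card_prod, Fintype.card_fin]
        ring

lemma sum_card_clashes_le (hJ : IsPairing J) (hN : 6 ≤ n * d) :
    ∑ σ, (clashes (conjPerm J σ)).card ≤ 4 * (d * (d + 1)) * (n * d).factorial := by
  have hpair : ∀ q : (Fin n × Fin d) × Fin d,
      (n * d - 1) * (n * d - 3) *
        (Finset.univ.filter fun σ => (q.1, (q.1.1, q.2)) ∈ clashes (conjPerm J σ)).card
      ≤ (n * d - 3 + n * d * d) * (n * d).factorial := by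
    intro q
    by_cases hq : q.1 = (q.1.1, q.2)
    · have : (Finset.univ.filter fun σ =>
          (q.1, (q.1.1, q.2)) ∈ clashes (conjPerm J σ)) = ∅ := by
        refine Finset.filter_eq_empty_iff.2 fun σ _ h => (mem_clashes.1 h).1 hq
      rw [this]
      simp
    · refine le_trans (Nat.mul_le_mul_left _ (Finset.card_le_card ?_))
        (card_fst_eq_mul_le hJ hq)
      intro σ hσ
      exact Finset.mem_filter.2 ⟨Finset.mem_univ _,
        (mem_clashes.1 (Finset.mem_filter.1 hσ).2).2.2⟩
  have hle : ∀ σ, (clashes (conjPerm J σ)).card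
      ≤ ∑ q : (Fin n × Fin d) × Fin d,
        if (q.1, (q.1.1, q.2)) ∈ clashes (conjPerm J σ) then 1 else 0 := by
    intro σ
    rw [← Finset.card_filter]
    refine Finset.card_le_card_of_injOn (fun z => (z.1, z.2.2)) ?_ ?_
    · rintro ⟨a, b⟩ hz
      have hab := (mem_clashes.1 (Finset.mem_coe.1 hz)).2.1
      simp only [Finset.coe_filter, Finset.mem_univ, true_and, Set.mem_ofPred_eq]
      rw [hab]
      exact hz
    · rintro ⟨a, b⟩ hz ⟨a', b'⟩ hz' h
      have hab := (mem_clashes.1 (Finset.mem_coe.1 hz)).2.1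
      have hab' := (mem_clashes.1 (Finset.mem_coe.1 hz')).2.1
      simp only [Prod.mk.injEq] at h
      rw [Prod.mk.injEq]
      exact ⟨h.1, Prod.ext (by rw [← hab, ← hab', h.1]) h.2⟩
  have htot : (n * d - 1) * (n * d - 3) * ∑ σ, (clashes (conjPerm J σ)).card
      ≤ n * d * d * ((n * d - 3 + n * d * d) * (n * d).factorial) := by
    calc (n * d - 1) * (n * d - 3) * ∑ σ, (clashes (conjPerm J σ)).card
        ≤ (n * d - 1) * (n * d - 3) * ∑ σ, ∑ q : (Fin n × Fin d) × Fin d,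
            if (q.1, (q.1.1, q.2)) ∈ clashes (conjPerm J σ) then 1 else 0 :=
          Nat.mul_le_mul_left _ (Finset.sum_le_sum fun σ _ => hle σ)
      _ = ∑ q : (Fin n × Fin d) × Fin d, (n * d - 1) * (n * d - 3) *
            (Finset.univ.filter fun σ =>
              (q.1, (q.1.1, q.2)) ∈ clashes (conjPerm J σ)).card := by
          rw [Finset.sum_comm, Finset.mul_sum]
          simp only [Finset.card_filter]
      _ ≤ ∑ _q : (Fin n × Fin d) × Fin d,
            (n * d - 3 + n * d * d) * (n * d).factorial :=
          Finset.sum_le_sum fun q _ => hpair q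
      _ = _ := by simp
  have harith : n * d * d * (n * d - 3 + n * d * d)
      ≤ (n * d - 1) * (n * d - 3) * (4 * (d * (d + 1))) := by
    obtain ⟨m, hm⟩ := Nat.exists_eq_add_of_le hN
    rw [hm, show 6 + m - 3 = 3 + m by omega, show 6 + m - 1 = 5 + m by omega]
    have : (6 + m) * (6 + m) ≤ (5 + m) * (3 + m) * 4 := by nlinarith
    calc (6 + m) * d * (3 + m + (6 + m) * d) ≤ (6 + m) * d * ((6 + m) + (6 + m) * d) := by
          gcongr
          omega
      _ = (6 + m) * (6 + m) * (d * (d + 1)) := by ring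
      _ ≤ (5 + m) * (3 + m) * 4 * (d * (d + 1)) := Nat.mul_le_mul_right _ this
      _ = _ := by ring
  have hpos : 0 < (n * d - 1) * (n * d - 3) := Nat.mul_pos (by omega) (by omega)
  refine Nat.le_of_mul_le_mul_left (htot.trans ?_) hpos
  rw [← mul_assoc, ← mul_assoc]
  exact Nat.mul_le_mul_right _ harith

/-- A uniform pairing of the half-edges of `n` vertices of degree `d` yields a simple graph with
probability bounded below uniformly in `n`. -/
lemma factorial_le_mul_card_clashes_eq_empty (hd : 1 ≤ d) (hJ : IsPairing J)
    (hn : 20 * (d * (d + 1)) ≤ n * d) :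
    (n * d).factorial ≤ 2 * (1 + 2 * (d * (d + 1))) ^ (8 * (d * (d + 1))) *
      (Finset.univ.filter fun σ => clashes (conjPerm J σ) = ∅).card := by
  set e := d * (d + 1) with he
  have he1 : 2 ≤ e := by nlinarith
  set B : ℕ → ℕ := fun b =>
    (Finset.univ.filter fun σ => (clashes (conjPerm J σ)).card < b).card with hB
  have hstep : ∀ b, b ≠ 0 → b ≤ 8 * e → B (b + 1) ≤ (1 + 2 * e) * B b := by
    intro b hb hb'
    have h1 := card_clashes_eq_mul_le (n := n) hJ hb
    rw [← he] at h1
    have h2 : B (b + 1) ≤ B b +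
        (Finset.univ.filter fun σ => (clashes (conjPerm J σ)).card = b).card := by
      refine (Finset.card_le_card ?_).trans (Finset.card_union_le _ _)
      intro σ hσ
      simp only [Finset.mem_union, Finset.mem_filter, Finset.mem_univ, true_and] at hσ ⊢
      omega
    have h3 : n * d ≤ 2 * (n * d - (2 * e + b)) := by omega
    have h4 : n * d * (Finset.univ.filter fun σ => (clashes (conjPerm J σ)).card = b).card
        ≤ n * d * (2 * e * B b) := by
      refine (Nat.mul_le_mul_right _ h3).trans ?_
      rw [mul_assoc]
      refine (Nat.mul_le_mul_left 2 h1).trans (le_of_eq ?_)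
      ring
    have h5 := Nat.le_of_mul_le_mul_left h4 (by omega)
    linarith
  have hiter : ∀ b, b ≤ 8 * e → B (b + 1) ≤ (1 + 2 * e) ^ b * B 1 := by
    intro b
    induction b with
    | zero => simp
    | succ b ih =>
      intro hb
      refine (hstep (b + 1) (by omega) hb).trans ?_
      rw [pow_succ', mul_assoc]
      exact Nat.mul_le_mul_left _ (ih (by omega))
  have hmarkov : (n * d).factorial ≤ 2 * B (8 * e + 1) := by
    have hsum := sum_card_clashes_le hJ (by omega : 6 ≤ n * d)
    rw [← he] at hsum
    set L := (Finset.univ.filter fun σ => ¬ (clashes (conjPerm J σ)).card < 8 * e + 1).card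
      with hL
    have h1 : B (8 * e + 1) + L = (n * d).factorial := by
      rw [hB, hL]
      simp only
      rw [Finset.card_filter_add_card_filter_not, Finset.card_univ, Fintype.card_perm]
      simp
    have h2 : L * (8 * e) ≤ ∑ σ, (clashes (conjPerm J σ)).card := by
      rw [hL, ← smul_eq_mul, ← Finset.sum_const]
      refine (Finset.sum_le_sum fun σ hσ => ?_).trans
        (Finset.sum_le_sum_of_subset (Finset.subset_univ _))
      have := (Finset.mem_filter.1 hσ).2
      omega
    have h3 : 4 * e * (2 * L) ≤ 4 * e * (n * d).factorial := by linarith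
    have h4 := Nat.le_of_mul_le_mul_left h3 (by omega)
    omega
  have hone : B 1 = (Finset.univ.filter fun σ => clashes (conjPerm J σ) = ∅).card := by
    simp [hB]
  rw [← hone]
  refine hmarkov.trans ?_
  rw [mul_assoc]
  exact Nat.mul_le_mul_left _ (hiter _ le_rfl)

end Counting

end Clashes

/-! ### Simple regular graphs from pairings -/

section ExistsPairing

variable {α : Type*} [Fintype α]

lemma exists_isPairing (h : Even (Fintype.card α)) : ∃ J : Equiv.Perm α, IsPairing J := by
  obtain ⟨m, hm⟩ := h
  have e : α ≃ Fin m ⊕ Fin m := Fintype.equivOfCardEq (by simp [hm])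
  refine ⟨(e.trans (Equiv.sumComm _ _)).trans e.symm, fun h => ?_, fun h hh => ?_⟩
  · simp
  · have := congrArg e hh
    rcases h' : e h with i | i <;> simp [h'] at this

variable [DecidableEq α] {p q : Equiv.Perm α}

lemma IsPairing.cycleType_eq (hp : IsPairing p) :
    p.cycleType = Multiset.replicate (Fintype.card α / 2) 2 := by
  have h2 : p ^ 2 = 1 := by
    ext h
    simp [sq, hp.1]
  have hrep := Equiv.Perm.cycleType_of_pow_prime_eq_one h2
  have hsupp : p.support = Finset.univ := by
    ext h
    simp [hp.2 h]
  have hsum := p.sum_cycleType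
  rw [hrep, hsupp, Finset.card_univ, Multiset.sum_replicate, smul_eq_mul] at hsum
  rw [hrep, ← hsum, Nat.mul_div_cancel _ two_pos]

lemma IsPairing.exists_conjPerm_eq (hp : IsPairing p) (hq : IsPairing q) :
    ∃ σ, TreeEntropy.conjPerm p σ = q :=
  isConj_iff.1 (Equiv.Perm.isConj_iff_cycleType_eq.2 (hp.cycleType_eq.trans hq.cycleType_eq.symm))

lemma IsPairing.card_conjPerm_eq (hp : IsPairing p) (hq : IsPairing q) :
    (Finset.univ.filter fun σ => TreeEntropy.conjPerm p σ = q).card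
      = (Finset.univ.filter fun σ => TreeEntropy.conjPerm p σ = p).card := by
  obtain ⟨τ, hτ⟩ := hp.exists_conjPerm_eq hq
  symm
  refine Finset.card_bij (fun σ _ => τ * σ) ?_ (fun _ _ _ _ h => mul_left_cancel h) ?_
  · intro σ hσ
    simp only [Finset.mem_filter, Finset.mem_univ, true_and] at hσ ⊢
    rw [conjPerm_mul, hσ, ← hτ, TreeEntropy.conjPerm]
  · intro σ hσ
    simp only [Finset.mem_filter, Finset.mem_univ, true_and] at hσ ⊢
    refine ⟨τ⁻¹ * σ, ?_, by group⟩
    rw [conjPerm_mul, hσ, ← hτ, TreeEntropy.conjPerm]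
    group

end ExistsPairing

section PairingGraph

variable {n d : ℕ}

/-- The simple graph underlying the multigraph obtained from a pairing of half-edges. -/
def pairingGraph (p : Equiv.Perm (Fin n × Fin d)) : SimpleGraph (Fin n) :=
  SimpleGraph.fromRel fun u w => ∃ i, (p (u, i)).1 = w

variable {p q : Equiv.Perm (Fin n × Fin d)} {G : SimpleGraph (Fin n)}

lemma IsPairing.exists_fst_eq_comm (hp : IsPairing p) {u w : Fin n}
    (h : ∃ i, (p (u, i)).1 = w) : ∃ i, (p (w, i)).1 = u := by
  obtain ⟨i, rfl⟩ := h
  exact ⟨(p (u, i)).2, by rw [Prod.mk.eta, hp.1]⟩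

lemma IsPairing.pairingGraph_adj (hp : IsPairing p) {u w : Fin n} :
    (pairingGraph p).Adj u w ↔ u ≠ w ∧ ∃ i, (p (u, i)).1 = w := by
  rw [pairingGraph, SimpleGraph.fromRel_adj]
  exact and_congr_right fun _ => ⟨fun h => h.elim id hp.exists_fst_eq_comm, Or.inl⟩

lemma IsPairing.fst_ne (hp : IsPairing p) (hc : clashes p = ∅) (h : Fin n × Fin d) :
    (p h).1 ≠ h.1 := by
  intro hh
  have : (h, p h) ∈ clashes p := mem_clashes.2 ⟨(hp.2 h).symm, hh.symm, by rw [hp.1, hh]⟩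
  simp [hc] at this

lemma IsPairing.pairingGraph_adj_of_clashes (hp : IsPairing p) (hc : clashes p = ∅)
    {u w : Fin n} : (pairingGraph p).Adj u w ↔ ∃ i, (p (u, i)).1 = w := by
  rw [hp.pairingGraph_adj, and_iff_right_iff_imp]
  rintro ⟨i, rfl⟩
  exact (hp.fst_ne hc (u, i)).symm

lemma fst_injective_of_clashes (hc : clashes p = ∅) (u : Fin n) :
    Function.Injective fun i => (p (u, i)).1 := by
  intro i j hij
  by_contra hne
  have : ((u, i), (u, j)) ∈ clashes p := mem_clashes.2 ⟨by simpa using hne, rfl, hij⟩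
  simp [hc] at this

lemma IsPairing.pairingGraph_mem_regularGraphs (hp : IsPairing p) (hc : clashes p = ∅) :
    pairingGraph p ∈ regularGraphs d n := by
  intro u
  have : (pairingGraph p).neighborSet u = Set.range fun i => (p (u, i)).1 := by
    ext w
    rw [SimpleGraph.mem_neighborSet, hp.pairingGraph_adj_of_clashes hc, Set.mem_range]
  rw [this, Set.ncard_range_of_injective (fst_injective_of_clashes hc u), Nat.card_fin]

/-- The labelings of the neighborhoods of the graph `G` given by a pairing. -/
def pairingLabels (G : SimpleGraph (Fin n))
    (p : {p : Equiv.Perm (Fin n × Fin d) //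
      IsPairing p ∧ clashes p = ∅ ∧ pairingGraph p = G}) (v : Fin n) :
    Fin d ≃ G.neighborSet v :=
  Equiv.ofBijective
    (fun i => ⟨(p.1 (v, i)).1, by
      have := (p.2.1.pairingGraph_adj_of_clashes p.2.2.1 (u := v)).2 ⟨i, rfl⟩
      rwa [p.2.2.2] at this⟩)
    ⟨fun i j hij => fst_injective_of_clashes p.2.2.1 v (congrArg Subtype.val hij), by
      rintro ⟨w, hw⟩
      rw [SimpleGraph.mem_neighborSet, ← p.2.2.2,
        p.2.1.pairingGraph_adj_of_clashes p.2.2.1] at hw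
      obtain ⟨i, hi⟩ := hw
      exact ⟨i, Subtype.ext hi⟩⟩

lemma pairingLabels_injective (G : SimpleGraph (Fin n)) :
    Function.Injective (pairingLabels (d := d) G) := by
  rintro ⟨p, hp, hpc, hpG⟩ ⟨q, hq, hqc, hqG⟩ h
  have hfst : ∀ a, (p a).1 = (q a).1 := fun a =>
    congrArg Subtype.val (congrArg (fun b => b a.1 a.2) h)
  refine Subtype.ext (Equiv.ext fun a => ?_)
  by_contra hne
  have : (p a, q a) ∈ clashes p := by
    refine mem_clashes.2 ⟨hne, hfst a, ?_⟩
    rw [hp.1, hfst, hq.1]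
  simp [hpc] at this

lemma pairingLabels_surjective (G : SimpleGraph (Fin n)) :
    Function.Surjective (pairingLabels (d := d) G) := by
  intro b
  have hadj : ∀ v i, G.Adj v (b v i) := fun v i => (b v i).2
  set f : Fin n × Fin d → Fin n × Fin d := fun h =>
    ((b h.1 h.2 : Fin n), (b (b h.1 h.2)).symm ⟨h.1, (hadj h.1 h.2).symm⟩) with hf
  have key : ∀ h k, f h = k ↔ ((b h.1 h.2 : Fin n) = k.1 ∧ (b k.1 k.2 : Fin n) = h.1) := by
    rintro ⟨v, i⟩ ⟨w, j⟩
    constructor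
    · intro hk
      rw [hf] at hk
      simp only [Prod.mk.injEq] at hk
      obtain ⟨rfl, rfl⟩ := hk
      simp
    · rintro ⟨h1, h2⟩
      dsimp only at h1 h2
      subst h1
      refine Prod.ext rfl ?_
      rw [hf]
      simp only
      rw [Equiv.symm_apply_eq]
      exact Subtype.ext h2.symm
  have hinv : Function.Involutive f := fun h => (key _ _).2 ((key h _).1 rfl).symm
  have hp : IsPairing (hinv.toPerm f) := by
    refine ⟨hinv, fun h hh => ?_⟩
    exact (hadj h.1 h.2).ne ((key _ _).1 hh).1.symm
  have hc : clashes (hinv.toPerm f) = ∅ := by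
    refine Finset.eq_empty_of_forall_notMem ?_
    rintro ⟨⟨v, i⟩, ⟨w, j⟩⟩ h
    rw [mem_clashes] at h
    obtain ⟨h1, h2, h3⟩ := h
    dsimp only at h2
    subst h2
    exact h1 (Prod.ext rfl ((b v).injective (Subtype.ext h3)))
  refine ⟨⟨hinv.toPerm f, hp, hc, ?_⟩, ?_⟩
  · ext u w
    rw [hp.pairingGraph_adj_of_clashes hc]
    constructor
    · rintro ⟨i, rfl⟩
      exact hadj u i
    · intro huw
      exact ⟨(b u).symm ⟨w, huw⟩, by simp [hf]⟩
  · funext v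
    ext i
    rfl

lemma card_pairings_eq (hG : G ∈ regularGraphs d n) :
    (Finset.univ.filter fun p : Equiv.Perm (Fin n × Fin d) =>
      IsPairing p ∧ clashes p = ∅ ∧ pairingGraph p = G).card = d.factorial ^ n := by
  have h1 := Fintype.card_congr
    (Equiv.ofBijective _ ⟨pairingLabels_injective (d := d) G, pairingLabels_surjective G⟩)
  rw [Fintype.card_subtype, Fintype.card_pi] at h1
  rw [h1, Finset.prod_congr rfl (g := fun _ => d.factorial), Finset.prod_const,
    Finset.card_univ, Fintype.card_fin]
  intro v _
  have hv : Fintype.card (G.neighborSet v) = d := by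
    rw [← hG v, ← Nat.card_coe_set_eq, Nat.card_eq_fintype_card]
  have e : Fin d ≃ G.neighborSet v := Fintype.equivOfCardEq (by simp [hv])
  rw [Fintype.card_equiv e, Fintype.card_fin]

variable {J : Equiv.Perm (Fin n × Fin d)}

lemma card_conjPerm_pairingGraph_eq (hJ : IsPairing J) (hG : G ∈ regularGraphs d n) :
    (Finset.univ.filter fun σ => clashes (conjPerm J σ) = ∅ ∧
      pairingGraph (conjPerm J σ) = G).card
      = d.factorial ^ n * (Finset.univ.filter fun σ => conjPerm J σ = J).card := by
  rw [← card_pairings_eq hG, ← smul_eq_mul, ← Finset.sum_const]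
  rw [Finset.card_eq_sum_card_fiberwise (f := conjPerm J)
    (t := Finset.univ.filter fun p : Equiv.Perm (Fin n × Fin d) =>
      IsPairing p ∧ clashes p = ∅ ∧ pairingGraph p = G)]
  · refine Finset.sum_congr rfl fun p hp => ?_
    rw [Finset.mem_filter] at hp
    rw [← hJ.card_conjPerm_eq hp.2.1, Finset.filter_filter]
    congr 1
    ext σ
    simp only [Finset.mem_filter, Finset.mem_univ, true_and, and_iff_right_iff_imp]
    rintro rfl
    exact hp.2.2
  · intro σ hσ
    simp only [Finset.coe_filter, Finset.mem_univ, true_and, Set.mem_ofPred_eq] at hσ ⊢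
    exact ⟨hJ.conjPerm σ, hσ⟩

lemma card_conjPerm_pairingGraph_mem (hJ : IsPairing J) (A : Set (SimpleGraph (Fin n))) :
    (Finset.univ.filter fun σ => clashes (conjPerm J σ) = ∅ ∧
      pairingGraph (conjPerm J σ) ∈ A).card
      = (regularGraphs d n ∩ A).ncard *
        (d.factorial ^ n * (Finset.univ.filter fun σ => conjPerm J σ = J).card) := by
  have hfin : (regularGraphs d n ∩ A).Finite := Set.toFinite _
  rw [Set.ncard_eq_toFinset_card _ hfin, ← smul_eq_mul (a := hfin.toFinset.card),
    ← Finset.sum_const]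
  rw [Finset.card_eq_sum_card_fiberwise (f := fun σ => pairingGraph (conjPerm J σ))
    (t := hfin.toFinset)]
  · refine Finset.sum_congr rfl fun G hG => ?_
    rw [Set.Finite.mem_toFinset] at hG
    rw [← card_conjPerm_pairingGraph_eq hJ hG.1, Finset.filter_filter]
    congr 1
    ext σ
    simp only [Finset.mem_filter, Finset.mem_univ, true_and]
    constructor
    · rintro ⟨⟨h1, -⟩, h2⟩
      exact ⟨h1, h2⟩
    · rintro ⟨h1, rfl⟩
      exact ⟨⟨h1, hG.2⟩, rfl⟩
  · intro σ hσ
    simp only [Finset.coe_filter, Finset.mem_univ, true_and, Set.mem_ofPred_eq] at hσ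
    simp only [Set.Finite.coe_toFinset]
    exact ⟨(hJ.conjPerm σ).pairingGraph_mem_regularGraphs hσ.1, hσ.2⟩

lemma card_clashes_eq_empty_eq (hJ : IsPairing J) :
    (Finset.univ.filter fun σ => clashes (conjPerm J σ) = ∅).card
      = (regularGraphs d n).ncard *
        (d.factorial ^ n * (Finset.univ.filter fun σ => conjPerm J σ = J).card) := by
  simpa using card_conjPerm_pairingGraph_mem hJ Set.univ

/-- Conditionally on the pairing being simple, its graph is a uniform regular graph. -/
lemma PrG_mul_card_clashes_eq_empty (hJ : IsPairing J) (A : Set (SimpleGraph (Fin n))) :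
    PrG d n A * (Finset.univ.filter fun σ => clashes (conjPerm J σ) = ∅).card
      = (Finset.univ.filter fun σ => clashes (conjPerm J σ) = ∅ ∧
          pairingGraph (conjPerm J σ) ∈ A).card := by
  rw [card_conjPerm_pairingGraph_mem hJ, card_clashes_eq_empty_eq hJ, PrG]
  rcases Nat.eq_zero_or_pos (regularGraphs d n).ncard with h0 | h0
  · have : (regularGraphs d n ∩ A).ncard = 0 :=
      Nat.eq_zero_of_le_zero (h0 ▸ Set.ncard_le_ncard Set.inter_subset_left (Set.toFinite _))
    simp [h0, this]
  · have : ((regularGraphs d n).ncard : ℝ) ≠ 0 := by positivity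
    push_cast
    field_simp

lemma card_clashes_eq_empty_pos (hJ : IsPairing J) (h : (regularGraphs d n).Nonempty) :
    0 < (Finset.univ.filter fun σ => clashes (conjPerm J σ) = ∅).card := by
  rw [card_clashes_eq_empty_eq hJ]
  have h1 : 0 < (regularGraphs d n).ncard := (Set.ncard_pos (Set.toFinite _)).2 h
  have h2 : 0 < (Finset.univ.filter fun σ => conjPerm J σ = J).card :=
    Finset.card_pos.2 ⟨1, Finset.mem_filter.2 ⟨Finset.mem_univ _, by simp [conjPerm]⟩⟩
  have := d.factorial_pos
  positivity

end PairingGraph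

/-! ### Locality of the breadth-first search exploration -/

lemma resS_resS {M : Type*} (r k : ℕ) (g : RCG M) : resS k (resS r g) = resS r (resS k g) := by
  ext1
  · funext l
    simp only [resS]
    split_ifs <;> rfl
  · funext p
    simp only [resS]
    split_ifs <;> rfl

lemma lipschitzWith_resS {M : Type*} (r : ℕ) : LipschitzWith 1 (resS (M := M) r) := by
  refine LipschitzWith.of_dist_le_mul fun a b => ?_
  rw [NNReal.coe_one, one_mul]
  refine Summable.tsum_le_tsum (fun k => ?_) (rcg_summable _ _) (rcg_summable _ _)
  by_cases h : resS k a = resS k b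
  · rw [if_pos h, if_pos (by rw [resS_resS, h, resS_resS])]
  · rw [if_neg h]
    split_ifs
    · positivity
    · exact le_rfl

lemma measurable_resS {M : Type*} (r : ℕ) : Measurable (resS (M := M) r) :=
  (lipschitzWith_resS r).continuous.measurable

section Locality

variable {n : ℕ} {G G' : SimpleGraph (Fin n)} {v : Fin n} {r : ℕ}

/-- The graphs `G` and `G'` have the same edges at all the endpoints of walks of length at most
`r` of `G` started at `v`. -/
def AgreeNear (G G' : SimpleGraph (Fin n)) (v : Fin n) (r : ℕ) : Prop :=
  ∀ u, (∃ p : G.Walk v u, p.length ≤ r) → ∀ w, G.Adj u w ↔ G'.Adj u w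

lemma exists_walk_length_succ (G : SimpleGraph (Fin n)) (v w : Fin n) (k : ℕ) :
    (∃ p : G.Walk v w, p.length = k + 1)
      ↔ ∃ u, (∃ p : G.Walk v u, p.length = k) ∧ G.Adj u w := by
  constructor
  · rintro ⟨p, hp⟩
    cases hq : p.reverse with
    | nil =>
      have := congrArg SimpleGraph.Walk.length hq
      simp [hp] at this
    | cons h q =>
      have := congrArg SimpleGraph.Walk.length hq
      simp [hp] at this
      exact ⟨_, ⟨q.reverse, by simp [this]⟩, h.symm⟩
  · rintro ⟨u, ⟨p, rfl⟩, h⟩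
    exact ⟨p.concat h, by simp⟩

lemma AgreeNear.exists_walk_iff (h : AgreeNear G G' v r) {k : ℕ} (hk : k ≤ r + 1) (w : Fin n) :
    (∃ p : G.Walk v w, p.length = k) ↔ ∃ p : G'.Walk v w, p.length = k := by
  induction k generalizing w with
  | zero =>
    constructor <;>
    · rintro ⟨p, hp⟩
      obtain rfl := SimpleGraph.Walk.eq_of_length_eq_zero hp
      exact ⟨SimpleGraph.Walk.nil, rfl⟩
  | succ k ih =>
    rw [exists_walk_length_succ, exists_walk_length_succ]
    refine exists_congr fun u => ?_
    rw [← ih (by omega)]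
    refine and_congr_right fun hu => h u ?_ w
    obtain ⟨p, hp⟩ := hu
    exact ⟨p, by omega⟩

lemma reachable_and_dist_eq_iff (G : SimpleGraph (Fin n)) (v w : Fin n) (k : ℕ) :
    (G.Reachable v w ∧ G.dist v w = k)
      ↔ (∃ p : G.Walk v w, p.length = k) ∧ ∀ j < k, ¬ ∃ p : G.Walk v w, p.length = j := by
  constructor
  · rintro ⟨hr, rfl⟩
    refine ⟨hr.exists_walk_length_eq_dist, ?_⟩
    rintro j hj ⟨p, rfl⟩
    exact absurd (SimpleGraph.dist_le p) (by omega)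
  · rintro ⟨⟨p, rfl⟩, h⟩
    have hr : G.Reachable v w := ⟨p⟩
    refine ⟨hr, le_antisymm (SimpleGraph.dist_le p) ?_⟩
    by_contra hlt
    exact h _ (by omega) hr.exists_walk_length_eq_dist

lemma AgreeNear.reachable_and_dist_eq_iff (h : AgreeNear G G' v r) {k : ℕ} (hk : k ≤ r)
    (w : Fin n) :
    (G.Reachable v w ∧ G.dist v w = k) ↔ (G'.Reachable v w ∧ G'.dist v w = k) := by
  rw [TreeEntropy.reachable_and_dist_eq_iff, TreeEntropy.reachable_and_dist_eq_iff,
    h.exists_walk_iff (by omega)]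
  refine and_congr_right fun _ => forall₂_congr fun j hj => ?_
  rw [h.exists_walk_iff (by omega)]

lemma AgreeNear.adj_iff (h : AgreeNear G G' v r) {k : ℕ} (hk : k ≤ r) {u : Fin n}
    (hu : G.Reachable v u ∧ G.dist v u = k) (w : Fin n) : G.Adj u w ↔ G'.Adj u w := by
  refine h u ?_ w
  obtain ⟨p, hp⟩ := hu.1.exists_walk_length_eq_dist
  exact ⟨p, by omega⟩

lemma mem_bfsLayer {σ : Equiv.Perm (Fin n)} {k : ℕ} {w : Fin n} (hw : w ∈ bfsLayer G v σ k) :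
    G.Reachable v w ∧ G.dist v w = k := by
  cases k with
  | zero =>
    rw [bfsLayer, List.mem_singleton] at hw
    subst hw
    exact ⟨SimpleGraph.Reachable.refl _, SimpleGraph.dist_self⟩
  | succ k =>
    simpa only [bfsLayer, List.mem_mergeSort, List.mem_filter, List.mem_finRange, true_and,
      decide_eq_true_eq] using hw

lemma AgreeNear.find?_bfsLayer (h : AgreeNear G G' v r) (σ : Equiv.Perm (Fin n)) {k : ℕ}
    (hk : k ≤ r) (w : Fin n) :
    (bfsLayer G v σ k).find? (fun u => decide (G.Adj u w))
      = (bfsLayer G v σ k).find? (fun u => decide (G'.Adj u w)) :=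
  List.find?_congr fun _ hu => decide_eq_decide.2 (h.adj_iff hk (mem_bfsLayer hu) w)

lemma AgreeNear.bfsLayer_eq (h : AgreeNear G G' v r) (σ : Equiv.Perm (Fin n)) {k : ℕ}
    (hk : k ≤ r) : bfsLayer G v σ k = bfsLayer G' v σ k := by
  induction k with
  | zero => rfl
  | succ k ih =>
    have hk' : k ≤ r := by omega
    rw [bfsLayer, bfsLayer, ← ih hk']
    simp only [h.find?_bfsLayer σ hk', h.reachable_and_dist_eq_iff hk]

lemma AgreeNear.bfsPathAux_eq (h : AgreeNear G G' v r) (σ : Equiv.Perm (Fin n)) {k : ℕ}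
    (hk : k ≤ r) (w : Fin n) : bfsPathAux G v σ k w = bfsPathAux G' v σ k w := by
  induction k generalizing w with
  | zero => rfl
  | succ k ih =>
    have hk' : k ≤ r := by omega
    simp only [bfsPathAux, ← h.bfsLayer_eq σ hk', ← h.bfsLayer_eq σ hk, h.find?_bfsLayer σ hk',
      ih hk']

lemma length_of_bfsPathAux {σ : Equiv.Perm (Fin n)} {k : ℕ} {w : Fin n} {l : List ℕ}
    (h : bfsPathAux G v σ k w = some l) : l.length = k := by
  induction k generalizing w l with
  | zero =>
    rw [bfsPathAux] at h
    split_ifs at h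
    cases h
    rfl
  | succ k ih =>
    rw [bfsPathAux] at h
    split at h
    · cases h
    · simp only [Option.map_eq_some_iff] at h
      obtain ⟨l', hl', rfl⟩ := h
      simp [ih hl']

lemma bfsPath_eq_some_iff {σ : Equiv.Perm (Fin n)} {w : Fin n} {l : List ℕ} :
    bfsPath G v σ w = some l
      ↔ (G.Reachable v w ∧ G.dist v w = l.length) ∧ bfsPathAux G v σ l.length w = some l := by
  rw [bfsPath]
  constructor
  · intro h
    split_ifs at h with hr
    have hl := length_of_bfsPathAux h
    exact ⟨⟨hr, hl.symm⟩, by rw [hl, h]⟩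
  · rintro ⟨⟨hr, hl⟩, h⟩
    rw [if_pos hr, hl, h]

lemma AgreeNear.bfsPath_eq_some_iff (h : AgreeNear G G' v r) (σ : Equiv.Perm (Fin n))
    {w : Fin n} {l : List ℕ} (hl : l.length ≤ r) :
    bfsPath G v σ w = some l ↔ bfsPath G' v σ w = some l := by
  rw [TreeEntropy.bfsPath_eq_some_iff, TreeEntropy.bfsPath_eq_some_iff,
    h.reachable_and_dist_eq_iff hl, h.bfsPathAux_eq σ hl]

lemma choose_eq_choose {α : Sort*} {P Q : α → Prop} (h : P = Q) (hP : ∃ a, P a)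
    (hQ : ∃ a, Q a) : hP.choose = hQ.choose := by
  subst h
  rfl

lemma AgreeNear.resS_bfsRCG_eq {M : Type*} (h : AgreeNear G G' v r) (f : Fin n → M)
    (σ : Equiv.Perm (Fin n)) :
    resS r (bfsRCG G f v σ) = resS r (bfsRCG G' f v σ) := by
  ext1
  · funext l
    simp only [resS]
    split_ifs with hl
    · have hP : (fun w => bfsPath G v σ w = some l) = fun w => bfsPath G' v σ w = some l :=
        funext fun w => propext (h.bfsPath_eq_some_iff σ hl)
      simp only [bfsRCG]
      by_cases he : ∃ w, bfsPath G v σ w = some l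
      · have he' : ∃ w, bfsPath G' v σ w = some l := 
          he.imp fun w hw => (h.bfsPath_eq_some_iff σ hl).1 hw
        rw [dif_pos he, dif_pos he', choose_eq_choose hP he he']
      · rw [dif_neg he, dif_neg (by simpa only [← h.bfsPath_eq_some_iff σ hl] using he)]
    · rfl
  · funext p
    simp only [resS]
    split_ifs with hl
    · refine if_congr (exists_congr fun w₁ => exists_congr fun w₂ => ?_) rfl rfl
      rw [← h.bfsPath_eq_some_iff σ hl.1, ← h.bfsPath_eq_some_iff σ hl.2]
      refine and_congr_right fun h1 => and_congr_right fun _ => ?_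
      exact h.adj_iff hl.1 (TreeEntropy.bfsPath_eq_some_iff.1 h1).1 w₂
    · rfl

lemma isProbabilityMeasure_distrAt {M : Type*} (G : SimpleGraph (Fin n)) (f : Fin n → M)
    (v : Fin n) : IsProbabilityMeasure (distrAt G f v) := by
  constructor
  have h0 : ((n.factorial : ℕ) : ℝ≥0∞) ≠ 0 := by exact_mod_cast n.factorial_ne_zero
  rw [distrAt, Measure.smul_apply, Measure.finsetSum_apply]
  simp [Fintype.card_perm, ENNReal.inv_mul_cancel h0 (ENNReal.natCast_ne_top _)]

lemma AgreeNear.map_distrAt_eq {M : Type*} (h : AgreeNear G G' v r) (f : Fin n → M) :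
    (distrAt G f v).map (resS r) = (distrAt G' f v).map (resS r) := by
  have hm := measurable_resS (M := M) r
  rw [distrAt, distrAt, Measure.map_smul, Measure.map_smul,
    Measure.map_finset_sum hm.aemeasurable, Measure.map_finset_sum hm.aemeasurable]
  congr 1
  refine Finset.sum_congr rfl fun σ _ => ?_
  rw [Measure.map_dirac' hm, Measure.map_dirac' hm, h.resS_bfsRCG_eq]

end Locality

/-! ### Lipschitz continuity of the logarithm of the partition function -/

section Lipschitz

variable {n d : ℕ}

lemma card_walk_length_eq_le {G : SimpleGraph (Fin n)} (hG : G ∈ regularGraphs d n) (u : Fin n)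
    (k : ℕ) :
    (Finset.univ.filter fun v => ∃ p : G.Walk u v, p.length = k).card ≤ d ^ k := by
  induction k with
  | zero =>
    rw [pow_zero]
    refine Finset.card_le_one.2 fun v hv w hw => ?_
    rw [Finset.mem_filter] at hv hw
    obtain ⟨-, p, hp⟩ := hv
    obtain ⟨-, q, hq⟩ := hw
    rw [← SimpleGraph.Walk.eq_of_length_eq_zero hp, ← SimpleGraph.Walk.eq_of_length_eq_zero hq]
  | succ k ih =>
    calc (Finset.univ.filter fun v => ∃ p : G.Walk u v, p.length = k + 1).card
        ≤ ((Finset.univ.filter fun v => ∃ p : G.Walk u v, p.length = k).biUnion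
            fun w => G.neighborFinset w).card := by
          refine Finset.card_le_card fun v hv => ?_
          rw [Finset.mem_filter, exists_walk_length_succ] at hv
          obtain ⟨-, w, hw, hwv⟩ := hv
          exact Finset.mem_biUnion.2 ⟨w, Finset.mem_filter.2 ⟨Finset.mem_univ _, hw⟩,
            (G.mem_neighborFinset w v).2 hwv⟩
      _ ≤ (Finset.univ.filter fun v => ∃ p : G.Walk u v, p.length = k).card * d := by
          refine Finset.card_biUnion_le_card_mul _ _ _ fun w _ => ?_
          rw [← Set.ncard_coe_finset, SimpleGraph.coe_neighborFinset, hG w]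
      _ ≤ d ^ (k + 1) := by
          rw [pow_succ]
          exact Nat.mul_le_mul_right _ ih

lemma card_exists_walk_le {G : SimpleGraph (Fin n)} (hG : G ∈ regularGraphs d n)
    (W : Finset (Fin n)) (r : ℕ) :
    (Finset.univ.filter fun v => ∃ u ∈ W, ∃ p : G.Walk v u, p.length ≤ r).card
      ≤ W.card * ∑ k ∈ Finset.range (r + 1), d ^ k := by
  calc (Finset.univ.filter fun v => ∃ u ∈ W, ∃ p : G.Walk v u, p.length ≤ r).card
      ≤ (W.biUnion fun u => (Finset.range (r + 1)).biUnion fun k =>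
          Finset.univ.filter fun v => ∃ p : G.Walk u v, p.length = k).card := by
        refine Finset.card_le_card fun v hv => ?_
        rw [Finset.mem_filter] at hv
        obtain ⟨-, u, hu, p, hp⟩ := hv
        refine Finset.mem_biUnion.2 ⟨u, hu, Finset.mem_biUnion.2 ⟨p.length, ?_, ?_⟩⟩
        · exact Finset.mem_range.2 (by omega)
        · exact Finset.mem_filter.2 ⟨Finset.mem_univ _, p.reverse, p.length_reverse⟩
    _ ≤ W.card * ∑ k ∈ Finset.range (r + 1), d ^ k :=
        Finset.card_biUnion_le_card_mul _ _ _ fun u _ => Finset.card_biUnion_le.trans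
          (Finset.sum_le_sum fun k _ => card_walk_length_eq_le hG u k)

lemma card_not_agreeNear_le {p q : Equiv.Perm (Fin n × Fin d)} (hp : IsPairing p)
    (hq : IsPairing q) (hpc : clashes p = ∅) (r : ℕ) :
    (Finset.univ.filter fun v => ¬ AgreeNear (pairingGraph p) (pairingGraph q) v r).card
      ≤ hammingDist p q * ∑ k ∈ Finset.range (r + 1), d ^ k := by
  have hdist : hammingDist p q = (Finset.univ.filter fun h => p h ≠ q h).card := by
    unfold hammingDist
    congr!
  rw [hdist]
  refine le_trans (Finset.card_le_card fun v hv => ?_)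
    ((card_exists_walk_le (hp.pairingGraph_mem_regularGraphs hpc)
      ((Finset.univ.filter fun h => p h ≠ q h).image Prod.fst) r).trans
      (Nat.mul_le_mul_right _ Finset.card_image_le))
  simp only [AgreeNear, Finset.mem_filter, Finset.mem_univ, true_and, not_forall] at hv ⊢
  obtain ⟨u, hu, w, hw⟩ := hv
  refine ⟨u, ?_, hu⟩
  by_contra hmem
  simp only [Finset.mem_image, Finset.mem_filter, Finset.mem_univ, true_and, not_exists,
    not_and] at hmem
  refine hw ?_
  rw [hp.pairingGraph_adj, hq.pairingGraph_adj]
  refine and_congr_right fun _ => exists_congr fun i => ?_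
  rw [not_not.1 fun h => hmem (u, i) h rfl]

variable {M : Type*} {G G' : SimpleGraph (Fin n)}

lemma isProbabilityMeasure_distrG (hn : 0 < n) (G : SimpleGraph (Fin n)) (f : Fin n → M) :
    IsProbabilityMeasure (distrG G f) := by
  constructor
  have h0 : (n : ℝ≥0∞) ≠ 0 := by exact_mod_cast hn.ne'
  have h1 : ∀ v, distrAt G f v Set.univ = 1 := fun v =>
    (isProbabilityMeasure_distrAt G f v).measure_univ
  rw [distrG, Measure.smul_apply, Measure.finsetSum_apply]
  simp [h1, ENNReal.inv_mul_cancel h0 (ENNReal.natCast_ne_top _)]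

lemma map_distrG_apply_le (f : Fin n → M) (r : ℕ) (B : Set (RCG M)) :
    (distrG G f).map (resS r) B ≤ (distrG G' f).map (resS r) B
      + (n : ℝ≥0∞)⁻¹ * (Finset.univ.filter fun v => ¬ AgreeNear G G' v r).card := by
  have hm := measurable_resS (M := M) r
  have hmap : ∀ G : SimpleGraph (Fin n), (distrG G f).map (resS r) B
      = (n : ℝ≥0∞)⁻¹ * ∑ v, (distrAt G f v).map (resS r) B := by
    intro G
    rw [distrG, Measure.map_smul, Measure.map_finset_sum hm.aemeasurable, Measure.smul_apply,
      Measure.finsetSum_apply, smul_eq_mul]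
  rw [hmap, hmap, ← mul_add]
  gcongr
  calc ∑ v, (distrAt G f v).map (resS r) B
      ≤ ∑ v, ((distrAt G' f v).map (resS r) B
          + if ¬ AgreeNear G G' v r then (1 : ℝ≥0∞) else 0) := by
        refine Finset.sum_le_sum fun v _ => ?_
        by_cases h : AgreeNear G G' v r
        · rw [h.map_distrAt_eq]
          exact le_self_add
        · rw [if_pos h]
          have := isProbabilityMeasure_distrAt G f v
          have := Measure.isProbabilityMeasure_map (μ := distrAt G f v) hm.aemeasurable
          exact prob_le_one.trans le_add_self
    _ = _ := by
        rw [Finset.sum_add_distrib, Finset.sum_boole]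

lemma AgreeNear.symm {v : Fin n} {r : ℕ} (h : AgreeNear G G' v r) : AgreeNear G' G v r := by
  rintro u ⟨p, hp⟩ w
  refine (h u ?_ w).symm
  obtain ⟨q, hq⟩ := (h.exists_walk_iff (k := p.length) (by omega) u).2 ⟨p, rfl⟩
  exact ⟨q, by omega⟩

lemma agreeNear_comm {v : Fin n} {r : ℕ} : AgreeNear G G' v r ↔ AgreeNear G' G v r :=
  ⟨AgreeNear.symm, AgreeNear.symm⟩

lemma levyProkhorovDist_distrG_le (hn : 0 < n) (f : Fin n → M) (r : ℕ) :
    levyProkhorovDist ((distrG G f).map (resS r)) ((distrG G' f).map (resS r))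
      ≤ (Finset.univ.filter fun v => ¬ AgreeNear G G' v r).card / n := by
  have hn' : (n : ℝ≥0∞) ≠ 0 := by exact_mod_cast hn.ne'
  have hE : levyProkhorovEDist ((distrG G f).map (resS r)) ((distrG G' f).map (resS r))
      ≤ (n : ℝ≥0∞)⁻¹ * (Finset.univ.filter fun v => ¬ AgreeNear G G' v r).card := by
    refine levyProkhorovEDist_le_of_forall _ _ _ fun ε B hε hε' _ => ?_
    have hpos : 0 < ε.toReal := ENNReal.toReal_pos (bot_lt_of_lt hε).ne' hε'.ne
    have hB := Metric.self_subset_thickening hpos B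
    constructor
    · exact (map_distrG_apply_le (G' := G') f r B).trans (add_le_add (measure_mono hB) hε.le)
    · have := map_distrG_apply_le (G := G') (G' := G) f r B
      simp only [agreeNear_comm (G := G') (G' := G)] at this
      exact this.trans (add_le_add (measure_mono hB) hε.le)
  have hfin : (n : ℝ≥0∞)⁻¹ * (Finset.univ.filter fun v => ¬ AgreeNear G G' v r).card ≠ ∞ :=
    ENNReal.mul_ne_top (ENNReal.inv_ne_top.2 hn') (ENNReal.natCast_ne_top _)
  refine (ENNReal.toReal_mono hfin hE).trans_eq ?_
  rw [ENNReal.toReal_mul, ENNReal.toReal_inv, ENNReal.toReal_natCast, ENNReal.toReal_natCast]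
  ring

lemma abs_log_sum_exp_sub_le {ι : Type*} [Fintype ι] {a b : ι → ℝ} {c : ℝ} (hc : 0 ≤ c)
    (h : ∀ i, |a i - b i| ≤ c) :
    |Real.log (∑ i, Real.exp (a i)) - Real.log (∑ i, Real.exp (b i))| ≤ c := by
  rcases isEmpty_or_nonempty ι with hι | hι
  · simpa using hc
  have hpos : ∀ a : ι → ℝ, 0 < ∑ i, Real.exp (a i) := fun a =>
    Finset.sum_pos (fun i _ => Real.exp_pos _) Finset.univ_nonempty
  have key : ∀ a b : ι → ℝ, (∀ i, a i ≤ c + b i) →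
      Real.log (∑ i, Real.exp (a i)) ≤ c + Real.log (∑ i, Real.exp (b i)) := by
    intro a b hab
    rw [← Real.log_exp c, ← Real.log_mul (Real.exp_pos _).ne' (hpos b).ne',
      Finset.mul_sum]
    refine Real.log_le_log (hpos a) (Finset.sum_le_sum fun i _ => ?_)
    rw [← Real.exp_add]
    exact Real.exp_le_exp.2 (hab i)
  have h1 := key a b fun i => by linarith [(abs_le.1 (h i)).2]
  have h2 := key b a fun i => by linarith [(abs_le.1 (h i)).1]
  exact abs_le.2 ⟨by linarith, by linarith⟩

variable [Fintype M] [MeasurableSpace M]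

lemma abs_log_ZGbeta_sub_le (hn : 0 < n) (μ : Measure (TdVertex d → M)) [IsFiniteMeasure μ]
    (r : ℕ) {β : ℝ} (hβ : 0 ≤ β) :
    |Real.log (ZGbeta d μ r β G) - Real.log (ZGbeta d μ r β G')|
      ≤ β * (Finset.univ.filter fun v => ¬ AgreeNear G G' v r).card := by
  refine abs_log_sum_exp_sub_le (by positivity) fun f => ?_
  have hprob : ∀ G : SimpleGraph (Fin n), IsProbabilityMeasure ((distrG G f).map (resS r)) :=
    fun G => by
      have := isProbabilityMeasure_distrG hn G f
      exact Measure.isProbabilityMeasure_map (measurable_resS r).aemeasurable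
  have h1 := hprob G
  have h2 := hprob G'
  have h3 : IsFiniteMeasure ((lawTd d μ).map (resS r)) := by
    unfold lawTd
    infer_instance
  have hd := levyProkhorovDist_distrG_le (G := G) (G' := G') hn f r
  have t1 := levyProkhorovDist_triangle ((distrG G f).map (resS r))
    ((distrG G' f).map (resS r)) ((lawTd d μ).map (resS r))
  have t2 := levyProkhorovDist_triangle ((distrG G' f).map (resS r))
    ((distrG G f).map (resS r)) ((lawTd d μ).map (resS r))
  rw [levyProkhorovDist_comm ((distrG G' f).map (resS r)) ((distrG G f).map (resS r))] at t2
  have habs := abs_le.2 ⟨neg_le_sub_iff_le_add'.2 t2, sub_le_iff_le_add.2 t1⟩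
  have hn' : (0 : ℝ) < n := by exact_mod_cast hn
  rw [← mul_sub, abs_mul, abs_mul, abs_neg, abs_of_pos hn', abs_of_nonneg hβ]
  calc _ ≤ (n : ℝ) * β * ((Finset.univ.filter fun v => ¬ AgreeNear G G' v r).card / n) := by
        gcongr
        exact habs.trans hd
    _ = _ := by field_simp

lemma abs_log_ZGbeta_pairingGraph_sub_le (hn : 0 < n) (μ : Measure (TdVertex d → M))
    [IsFiniteMeasure μ] (r : ℕ) {β : ℝ} (hβ : 0 ≤ β) {p q : Equiv.Perm (Fin n × Fin d)}
    (hp : IsPairing p) (hq : IsPairing q) (hpc : clashes p = ∅) :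
    |Real.log (ZGbeta d μ r β (pairingGraph p)) - Real.log (ZGbeta d μ r β (pairingGraph q))|
      ≤ β * (∑ k ∈ Finset.range (r + 1), (d : ℝ) ^ k) * hammingDist p q := by
  refine (abs_log_ZGbeta_sub_le hn μ r hβ).trans ?_
  rw [mul_assoc]
  gcongr
  have := card_not_agreeNear_le hp hq hpc r
  rw [mul_comm] at this
  exact_mod_cast this

end Lipschitz

/-! ### Concentration -/

section Concentration

/-- The McShane extension of a function on a finite set. -/
lemma exists_extension_of_abs_sub_le {α : Type*} {S : Finset α} (hS : S.Nonempty) {F : α → ℝ}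
    {δ : α → α → ℝ} (hself : ∀ x, δ x x = 0) (hcomm : ∀ x y, δ x y = δ y x)
    (htri : ∀ x y z, δ x z ≤ δ x y + δ y z) (hF : ∀ x ∈ S, ∀ y ∈ S, |F x - F y| ≤ δ x y) :
    ∃ f : α → ℝ, (∀ x ∈ S, f x = F x) ∧ ∀ x y, |f x - f y| ≤ δ x y := by
  refine ⟨fun x => S.inf' hS fun y => F y + δ x y, fun x hx => le_antisymm ?_ ?_, ?_⟩
  · exact (Finset.inf'_le _ hx).trans_eq (by rw [hself, add_zero])
  · refine Finset.le_inf' hS _ fun y hy => ?_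
    linarith [(abs_le.1 (hF x hx y hy)).2]
  · have key : ∀ x y, (S.inf' hS fun z => F z + δ x z)
        ≤ δ x y + S.inf' hS fun z => F z + δ y z := by
      intro x y
      obtain ⟨z, hz, hz'⟩ := Finset.exists_mem_eq_inf' hS fun z => F z + δ y z
      rw [hz']
      refine (Finset.inf'_le _ hz).trans ?_
      linarith [htri x y z]
    intro x y
    have h1 := key x y
    have h2 := key y x
    rw [hcomm y x] at h2
    exact abs_le.2 ⟨by linarith, by linarith⟩

lemma hammingDist_conjPerm_swap_mul_le {α : Type*} [Fintype α] [DecidableEq α]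
    {J : Equiv.Perm α} (hJ : IsPairing J) (x y : α) (σ : Equiv.Perm α) :
    hammingDist (conjPerm J (Equiv.swap x y * σ)) (conjPerm J σ) ≤ 4 := by
  set p := conjPerm J σ with hp
  have hpp := hJ.conjPerm σ
  rw [← hp] at hpp
  calc hammingDist (conjPerm J (Equiv.swap x y * σ)) p
      ≤ ({x, y, p x, p y} : Finset α).card := by
        refine Finset.card_le_card fun h hh => ?_
        rw [Finset.mem_filter] at hh
        by_contra hmem
        simp only [Finset.mem_insert, Finset.mem_singleton, not_or] at hmem
        obtain ⟨hx, hy, hpx, hpy⟩ := hmem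
        refine hh.2 ?_
        rw [conjPerm_swap_mul_apply, Equiv.swap_apply_of_ne_of_ne hx hy,
          Equiv.swap_apply_of_ne_of_ne]
        · intro h'
          exact hpx (by rw [← h', hpp.1])
        · intro h'
          exact hpy (by rw [← h', hpp.1])
    _ ≤ 4 := Finset.card_le_four

variable {n d : ℕ} {J : Equiv.Perm (Fin n × Fin d)}

lemma factorial_le_mul_card_of_nonempty (hd : 1 ≤ d) (hJ : IsPairing J)
    (hne : (regularGraphs d n).Nonempty) :
    (n * d).factorial ≤ (2 * (1 + 2 * (d * (d + 1))) ^ (8 * (d * (d + 1)))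
      + (20 * (d * (d + 1))).factorial) *
      (Finset.univ.filter fun σ => clashes (conjPerm J σ) = ∅).card := by
  rw [add_mul]
  rcases le_total (20 * (d * (d + 1))) (n * d) with h | h
  · exact (factorial_le_mul_card_clashes_eq_empty hd hJ h).trans (Nat.le_add_right _ _)
  · exact ((Nat.factorial_le h).trans
      (Nat.le_mul_of_pos_right _ (card_clashes_eq_empty_pos hJ hne))).trans (Nat.le_add_left _ _)

/-- A function of a uniform regular graph which is Lipschitz with respect to the pairing of
half-edges is concentrated. -/
lemma exists_PrG_le (hd : 1 ≤ d) (hJ : IsPairing J) {F : SimpleGraph (Fin n) → ℝ} {c : ℝ}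
    (hc : 0 ≤ c)
    (hF : ∀ p q : Equiv.Perm (Fin n × Fin d), IsPairing p → IsPairing q → clashes p = ∅ →
      clashes q = ∅ → |F (pairingGraph p) - F (pairingGraph q)| ≤ c * hammingDist p q) :
    ∃ s : ℝ, ∀ t : ℝ, 0 < t → PrG d n {G | t ≤ |F G - s|}
      ≤ 2 * ((2 * (1 + 2 * (d * (d + 1))) ^ (8 * (d * (d + 1)))
          + (20 * (d * (d + 1))).factorial : ℕ) : ℝ)
        * Real.exp (-t ^ 2 / (8 * (4 * c) ^ 2 * (n * d : ℕ))) := by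
  set K := 2 * (1 + 2 * (d * (d + 1))) ^ (8 * (d * (d + 1))) + (20 * (d * (d + 1))).factorial
    with hK
  rcases (regularGraphs d n).eq_empty_or_nonempty with hne | hne
  · refine ⟨0, fun t _ => ?_⟩
    rw [PrG, hne]
    simp only [Set.empty_inter, Set.ncard_empty, Nat.cast_zero, div_zero]
    positivity
  set S := Finset.univ.filter fun σ => clashes (conjPerm J σ) = ∅ with hS
  have hSpos : 0 < S.card := card_clashes_eq_empty_pos hJ hne
  obtain ⟨f, hfS, hf⟩ := exists_extension_of_abs_sub_le (Finset.card_pos.1 hSpos)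
    (F := fun σ => F (pairingGraph (conjPerm J σ)))
    (δ := fun σ τ => c * hammingDist (conjPerm J σ) (conjPerm J τ))
    (fun σ => by simp) (fun σ τ => by rw [hammingDist_comm])
    (fun σ τ ρ => by
      rw [← mul_add]
      gcongr
      exact_mod_cast hammingDist_triangle _ _ _)
    (fun σ hσ τ hτ => hF _ _ (hJ.conjPerm σ) (hJ.conjPerm τ) (Finset.mem_filter.1 hσ).2
      (Finset.mem_filter.1 hτ).2)
  have hlip : SwapLipschitz (4 * c) f := by
    intro x y σ
    refine (hf _ _).trans ?_
    rw [mul_comm 4 c]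
    gcongr
    exact_mod_cast hammingDist_conjPerm_swap_mul_le hJ x y σ
  obtain ⟨s, hs⟩ := exists_card_swapLipschitz_tail_le f hlip
  refine ⟨s, fun t ht => ?_⟩
  have hst := hs t ht
  rw [Fintype.card_prod, Fintype.card_fin, Fintype.card_fin] at hst
  set e := Real.exp (-t ^ 2 / (8 * (4 * c) ^ 2 * (n * d : ℕ))) with he
  have hfac : ((n * d).factorial : ℝ) ≤ K * S.card := by
    exact_mod_cast factorial_le_mul_card_of_nonempty hd hJ hne
  have hcard : ((Finset.univ.filter fun σ => clashes (conjPerm J σ) = ∅ ∧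
      pairingGraph (conjPerm J σ) ∈ {G | t ≤ |F G - s|}).card : ℝ)
      ≤ (Finset.univ.filter fun σ => t ≤ |f σ - s|).card := by
    refine Nat.cast_le.2 (Finset.card_le_card fun σ hσ => ?_)
    simp only [Finset.mem_filter, Finset.mem_univ, true_and, Set.mem_ofPred_eq] at hσ ⊢
    rw [hfS σ (Finset.mem_filter.2 ⟨Finset.mem_univ _, hσ.1⟩)]
    exact hσ.2
  rw [← PrG_mul_card_clashes_eq_empty hJ] at hcard
  have hSpos' : (0 : ℝ) < S.card := by exact_mod_cast hSpos
  refine le_of_mul_le_mul_right ?_ hSpos'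
  calc PrG d n {G | t ≤ |F G - s|} * S.card
      ≤ (n * d).factorial * (2 * e) := hcard.trans hst
    _ ≤ K * S.card * (2 * e) := by gcongr
    _ = _ := by ring

end Concentration

/-- Concentration of the relaxed partition function
`Z_G(β) = ∑_f exp(-nβ d(distr_G(f)_r, μ_r))`: there are a constant `C` depending only on
`(d,r)` and deterministic numbers `s_n(β)` such that for all `t > 0`,
`ℙ(|(1/n) ln Z_{G_n}(β) - s_n(β)| ≥ t) ≤ C exp(-n t² / (Cβ)²)`. -/
theorem ZGbeta_concentration
    (d : ℕ) (hd : 3 ≤ d) (M : Type) [Fintype M] [MeasurableSpace M]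
    [DiscreteMeasurableSpace M] (r : ℕ) :
    ∃ C : ℝ, 0 < C ∧
      ∀ μ : Measure (TdVertex d → M), μ ∈ InvMeas d M → ∀ β : ℝ, 0 < β →
        ∃ s : ℕ → ℝ, ∀ n : ℕ, d - 1 ≤ n → Even (n * d) → ∀ t : ℝ, 0 < t →
          PrG d n {G : SimpleGraph (Fin n) |
              t ≤ |Real.log (ZGbeta d μ r β G) / n - s n|}
            ≤ C * Real.exp (-(n : ℝ) * t ^ 2 / (C * β) ^ 2) := by
  set K := 2 * (1 + 2 * (d * (d + 1))) ^ (8 * (d * (d + 1))) + (20 * (d * (d + 1))).factorial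
    with hK
  set B : ℝ := ∑ k ∈ Finset.range (r + 1), (d : ℝ) ^ k with hB
  have hdpos : (0 : ℝ) < d := by
    have : 0 < d := by omega
    exact_mod_cast this
  have hBpos : 0 < B := Finset.sum_pos (fun k _ => pow_pos hdpos k) (by simp)
  have hKone : (1 : ℝ) ≤ K := by
    have := (20 * (d * (d + 1))).factorial_pos
    exact_mod_cast (show 1 ≤ K by omega)
  set C : ℝ := 2 * K + 128 * d * B ^ 2 with hC
  have hCK : 2 * (K : ℝ) ≤ C := by
    have : 0 ≤ 128 * d * B ^ 2 := by positivity
    linarith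
  have hCB : 128 * d * B ^ 2 ≤ C ^ 2 := by
    have h1 : 1 ≤ C := by linarith
    nlinarith
  have hCpos : 0 < C := by linarith
  refine ⟨C, hCpos, fun μ hμ β hβ => ?_⟩
  have hμ' : IsProbabilityMeasure μ := hμ.1
  suffices h : ∀ n : ℕ, ∃ s : ℝ, d - 1 ≤ n → Even (n * d) → ∀ t : ℝ, 0 < t →
      PrG d n {G : SimpleGraph (Fin n) | t ≤ |Real.log (ZGbeta d μ r β G) / n - s|}
        ≤ C * Real.exp (-(n : ℝ) * t ^ 2 / (C * β) ^ 2) by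
    choose s hs using h
    exact ⟨s, hs⟩
  intro n
  by_cases hn : d - 1 ≤ n ∧ Even (n * d)
  swap
  · exact ⟨0, fun h1 h2 => absurd ⟨h1, h2⟩ hn⟩
  have hn0 : 0 < n := by omega
  have hnpos : (0 : ℝ) < n := by exact_mod_cast hn0
  obtain ⟨J, hJ⟩ := exists_isPairing (α := Fin n × Fin d) (by simpa using hn.2)
  obtain ⟨s, hs⟩ := exists_PrG_le (by omega) hJ
    (F := fun G => Real.log (ZGbeta d μ r β G) / n) (c := β * B / n) (by positivity)
    (fun p q hp hq hpc _ => by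
      rw [← sub_div, abs_div, abs_of_pos hnpos, div_mul_eq_mul_div]
      gcongr
      exact abs_log_ZGbeta_pairingGraph_sub_le hn0 μ r hβ.le hp hq hpc)
  refine ⟨s, fun _ _ t ht => (hs t ht).trans ?_⟩
  refine mul_le_mul hCK (Real.exp_le_exp.2 ?_) (Real.exp_pos _).le hCpos.le
  have hden : 8 * (4 * (β * B / n)) ^ 2 * ((n * d : ℕ) : ℝ) = 128 * d * B ^ 2 * β ^ 2 / n := by
    push_cast
    field_simp
    ring
  rw [hden, neg_mul, neg_div, neg_div, neg_le_neg_iff, div_div_eq_mul_div, mul_comm (t ^ 2),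
    mul_pow]
  gcongr

end TreeEntropy
end
end

section
/- Let F be a finite set, n ≥ 1 an integer, and Z = (Z_1,…,Z_n) a random exchangeable vector taking values in F^n. Let N_Z = Σ_{i=1}^n δ_{Z_i} be the counting measure associated to Z, i.e. N_Z(x) = #{ i : Z_i = x } for x ∈ F. Then the Shannon entropies satisfy H(Z) = H(N_Z) − Σ_{x∈F} E[ log(N_Z(x)!) ] + log(n!). -/
open MeasureTheory Filter Topology
open scoped ENNReal Classical

noncomputable section

namespace TreeEntropy

variable {M : Type*}

/-! ### Invariant processes on `T_d` and their entropies -/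

variable (d : ℕ) (M : Type*)

variable {d M}

/-! ### The randomly labeled rooted colored graph associated to a finite colored graph

Given a finite colored graph `(G,f)` and a vertex `v`, the associated randomly labeled rooted
colored graph is obtained by a breadth-first search exploration of the connected component of
`v` started at `v`, ties between vertices being broken uniformly at random.  We implement the
uniformly random tie-breaking by a uniformly random priority permutation `σ`. -/

variable {M : Type*} {n : ℕ}

variable {M : Type*}

/-- The counting measure `x ↦ #{i : z i = x}` of a finite vector `z`. -/
def countVec {ι F : Type*} [Fintype ι] (z : ι → F) (x : F) : ℕ :=
  (Finset.univ.filter (fun i => z i = x)).card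

lemma countVec_comp_perm {ι F : Type*} [Fintype ι] (z : ι → F) (σ : Equiv.Perm ι) :
    countVec (z ∘ σ) = countVec z := by
  funext x
  exact Finset.card_equiv σ (by simp)

lemma countVec_eq_iff {ι F : Type*} [Fintype ι] {z w : ι → F} :
    countVec w = countVec z ↔ ∃ σ : Equiv.Perm ι, w = z ∘ σ := by
  refine ⟨fun h => ?_, fun ⟨σ, hσ⟩ => hσ ▸ countVec_comp_perm z σ⟩
  have e : ∀ x, Nonempty ({i // w i = x} ≃ {i // z i = x}) := fun x =>
    Fintype.card_eq.mp (by simpa [Fintype.card_subtype, countVec] using congrFun h x)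
  exact ⟨Equiv.ofFiberEquiv fun x => (e x).some,
    funext fun i => (Equiv.ofFiberEquiv_map (fun x => (e x).some) i).symm⟩

/-- The number of rearrangements of a vector is a multinomial coefficient. -/
lemma card_countVec_fiber_mul_prod_factorial {ι F : Type*} [Fintype ι] [Fintype F] (z : ι → F) :
    Nat.card {w : ι → F // countVec w = countVec z} * ∏ x, (countVec z x).factorial =
      (Fintype.card ι).factorial := by
  have horb : MulAction.orbit (Equiv.Perm ι)ᵈᵐᵃ z = {w | countVec w = countVec z} := by
    ext w
    rw [Set.mem_ofPred_eq, countVec_eq_iff]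
    exact ⟨fun ⟨g, hg⟩ => ⟨DomMulAct.mk.symm g, hg.symm⟩,
      fun ⟨σ, hσ⟩ => ⟨DomMulAct.mk σ, hσ.symm⟩⟩
  have hstab : Nat.card (MulAction.stabilizer (Equiv.Perm ι)ᵈᵐᵃ z) =
      ∏ x, (countVec z x).factorial := by
    rw [Nat.card_congr MulOpposite.opEquiv,
      Nat.card_congr (DomMulAct.stabilizerMulEquiv z).toEquiv, Nat.card_pi]
    refine Finset.prod_congr rfl fun x _ => ?_
    rw [Nat.card_eq_fintype_card, Fintype.card_perm, Fintype.card_subtype, countVec]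
  have h := Nat.card_congr (MulAction.orbitProdStabilizerEquivGroup (Equiv.Perm ι)ᵈᵐᵃ z)
  rw [Nat.card_prod, hstab, horb, ← Nat.card_congr DomMulAct.mk,
    Nat.card_eq_fintype_card (α := Equiv.Perm ι), Fintype.card_perm] at h
  exact h

/-- The entropy of a random variable with finitely many values, in terms of the entropy of a
statistic `N` whose fibres carry uniform conditional laws. -/
lemma sum_negMulLog_fiberwise {α β : Type*} [Fintype α] (N : α → β) (p : α → ℝ)
    (hp : ∀ z w, N w = N z → p w = p z) :
    ∑ z, Real.negMulLog (p z) =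
      ∑ a ∈ Finset.univ.image N, Real.negMulLog (∑ z with N z = a, p z)
        + ∑ z, p z * Real.log (Nat.card {w // N w = N z}) := by
  rw [← Finset.sum_fiberwise_of_maps_to (s := Finset.univ) (t := Finset.univ.image N) (g := N)
      (fun z _ => Finset.mem_image_of_mem N (Finset.mem_univ z)) (fun z => Real.negMulLog (p z)),
    ← Finset.sum_fiberwise_of_maps_to (s := Finset.univ) (t := Finset.univ.image N) (g := N)
      (fun z _ => Finset.mem_image_of_mem N (Finset.mem_univ z))
      (fun z => p z * Real.log (Nat.card {w // N w = N z})),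
    ← Finset.sum_add_distrib]
  refine Finset.sum_congr rfl fun a ha => ?_
  obtain ⟨z, -, rfl⟩ := Finset.mem_image.mp ha
  have hconst : ∀ f : α → ℝ, (∀ w, N w = N z → f w = f z) →
      ∑ w with N w = N z, f w = Nat.card {w // N w = N z} * f z := by
    intro f hf
    rw [Finset.sum_congr rfl (fun w hw => hf w (Finset.mem_filter.mp hw).2)]
    simp [Fintype.card_subtype]
  rw [hconst p (hp z), hconst _ (fun w hw => by simp only [hp z w hw]),
    hconst _ (fun w hw => by simp only [hp z w hw, hw])]
  rw [Real.negMulLog_mul]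
  simp only [Real.negMulLog]
  ring

lemma measureReal_map_singleton {α β : Type*} [Fintype α] [MeasurableSpace α]
    [DiscreteMeasurableSpace α] [MeasurableSpace β] [MeasurableSingletonClass β]
    (μ : Measure α) [IsFiniteMeasure μ] (N : α → β) (a : β) :
    (μ.map N {a}).toReal = ∑ z with N z = a, (μ {z}).toReal := by
  rw [Measure.map_apply (measurable_of_countable N) (measurableSet_singleton a)]
  have := sum_measureReal_singleton (μ := μ) (Finset.univ.filter (fun z => N z = a))
  simp only [Measure.real] at this
  rw [this]
  congr 2
  ext; simp

lemma shannon_map {α β : Type*} [Fintype α] [MeasurableSpace α]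
    [DiscreteMeasurableSpace α] [MeasurableSpace β] [MeasurableSingletonClass β]
    (μ : Measure α) [IsFiniteMeasure μ] (N : α → β) :
    shannon (μ.map N) =
      ∑ a ∈ Finset.univ.image N, Real.negMulLog (∑ z with N z = a, (μ {z}).toReal) := by
  unfold shannon
  simp only [measureReal_map_singleton]
  refine tsum_eq_sum fun a ha => ?_
  have h : Finset.univ.filter (fun z => N z = a) = ∅ :=
    Finset.filter_eq_empty_iff.mpr fun z _ hz =>
      ha (Finset.mem_image.mpr ⟨z, Finset.mem_univ z, hz⟩)
  simp [h]

/-- Entropy of an exchangeable vector: if `Z = (Z_1,…,Z_n)` is a random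
exchangeable vector with values in `F^n` and `N_Z(x) = #{i : Z_i = x}` is the associated
counting measure, then `H(Z) = H(N_Z) - ∑_{x ∈ F} E[log N_Z(x)!] + log n!`. -/
theorem exchangeable_entropy
    (F : Type) [Fintype F] [MeasurableSpace F] [DiscreteMeasurableSpace F]
    (n : ℕ) (hn : 1 ≤ n)
    (μ : Measure (Fin n → F)) (hprob : IsProbabilityMeasure μ)
    (hexch : ∀ σ : Equiv.Perm (Fin n), μ.map (fun z => fun i => z (σ i)) = μ) :
    shannon μ =
      shannon (μ.map (fun z => fun x : F => (Finset.univ.filter (fun i => z i = x)).card))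
        - (∑ x : F, ∑ z : Fin n → F, (μ {z}).toReal *
            Real.log (Nat.factorial ((Finset.univ.filter (fun i => z i = x)).card)))
        + Real.log (Nat.factorial n) := by
  have hpinv : ∀ z w : Fin n → F, countVec w = countVec z →
      (μ {w}).toReal = (μ {z}).toReal := by
    intro z w h
    obtain ⟨σ, rfl⟩ := countVec_eq_iff.mp h
    conv_lhs => rw [← hexch σ]
    rw [Measure.map_apply (measurable_of_countable _) (measurableSet_singleton _)]
    congr 2
    ext y
    exact σ.surjective.injective_comp_right.eq_iff
  have hlog : ∀ z : Fin n → F,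
      Real.log (Nat.card {w : Fin n → F // countVec w = countVec z}) =
        Real.log n.factorial - ∑ x, Real.log (countVec z x).factorial := by
    intro z
    have h := card_countVec_fiber_mul_prod_factorial z
    rw [Fintype.card_fin] at h
    rw [← h, Nat.cast_mul, Nat.cast_prod, Real.log_mul, Real.log_prod]
    · ring
    · exact fun x _ => Nat.cast_ne_zero.mpr (Nat.factorial_ne_zero _)
    · have : Nonempty {w : Fin n → F // countVec w = countVec z} := ⟨z, rfl⟩
      exact Nat.cast_ne_zero.mpr Nat.card_pos.ne'
    · exact Finset.prod_ne_zero_iff.mpr fun x _ => Nat.cast_ne_zero.mpr (Nat.factorial_ne_zero _)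
  have hsum : ∑ z : Fin n → F, (μ {z}).toReal = 1 := by
    have h := sum_measureReal_singleton (μ := μ) Finset.univ
    simpa [Measure.real] using h
  change shannon μ = shannon (μ.map countVec)
    - (∑ x : F, ∑ z : Fin n → F, (μ {z}).toReal * Real.log (countVec z x).factorial)
    + Real.log n.factorial
  rw [shannon_map, shannon, tsum_fintype, sum_negMulLog_fiberwise countVec _ hpinv]
  simp only [hlog, mul_sub, Finset.sum_sub_distrib, ← Finset.sum_mul, hsum, Finset.mul_sum]
  rw [Finset.sum_comm]
  ring

end TreeEntropy
end
end
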